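/- arXiv:1210.7226 — 2 statements merged into one kernel-verified Lean document; each statement's English description precedes it below -/
import Mathlib

section
/- Let u be a continuous function on B₂ ⊂ ℝⁿ and 0 ≤ β ≤ L. There exists η₀ > 0 depending only on n and L such that for 0 < η ≤ η₀: if ‖u − U_β‖_{L∞(B₂)} ≤ η and {xₙ ≤ −η} ⊂ B₂ ∩ {u⁺ = 0} ⊂ {xₙ ≤ η}, then: (i) if β ≥ η^{1/3}, then U_β(xₙ − η^{1/3}) ≤ u(x) ≤ U_β(xₙ + η^{1/3}) for all x ∈ B₁; (ii) if β < η^{1/3}, then U₀(xₙ − η^{1/3}) ≤ u⁺(x) ≤ U₀(xₙ + η^{1/3}) for all x ∈ B₁. -/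
open Metric Set Filter
open scoped RealInnerProductSpace NNReal Topology Classical

noncomputable section

/-- `n`-dimensional Euclidean space. -/
abbrev En (n : ℕ) : Type := EuclideanSpace ℝ (Fin n)

namespace TwoPhase

variable {n : ℕ}

/-- The last (vertical) coordinate `xₙ` of a point of `ℝ^{n+1}`. -/
def xN (x : En (n + 1)) : ℝ := x (Fin.last n)

/-- The horizontal part `x'` (the first `n` coordinates). -/
def xT (x : En (n + 1)) : En n :=
  (EuclideanSpace.equiv (Fin n) ℝ).symm fun i => x i.castSucc

/-- The vertical unit vector `eₙ`. -/
def eN (n : ℕ) : En (n + 1) := EuclideanSpace.single (Fin.last n) 1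

/-- Positive part `t⁺ = max(t,0)`. -/
def pos (t : ℝ) : ℝ := max t 0

/-- Negative part `t⁻ = max(-t,0)`. -/
def neg (t : ℝ) : ℝ := max (-t) 0

/-- The two-plane profile `U_β(t) = α t⁺ - β t⁻` with `α = √(1+β²)`. -/
def U (β t : ℝ) : ℝ := Real.sqrt (1 + β ^ 2) * pos t - β * neg t

/-- The coordinate Laplacian of a function. -/
def lap (φ : En n → ℝ) (x : En n) : ℝ :=
  ∑ i : Fin n,
    fderiv ℝ (fun y => fderiv ℝ φ y (EuclideanSpace.single i 1)) x (EuclideanSpace.single i 1)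

/-- The second order operator `𝓛φ = Σ aᵢⱼ Dᵢⱼφ + b·∇φ`. -/
def ellOp (a : En n → Matrix (Fin n) (Fin n) ℝ) (b : En n → En n)
    (φ : En n → ℝ) (x : En n) : ℝ :=
  (∑ i : Fin n, ∑ j : Fin n, a x i j *
      fderiv ℝ (fun y => fderiv ℝ φ y (EuclideanSpace.single j 1)) x
        (EuclideanSpace.single i 1))
    + fderiv ℝ φ x (b x)

/-- The positivity set `Ω⁺(u) = {x ∈ Ω : u(x) > 0}`. -/
def Op (Ω : Set (En n)) (u : En n → ℝ) : Set (En n) := {x ∈ Ω | 0 < u x}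

/-- The negativity set `Ω⁻(u) = int {x ∈ Ω : u(x) ≤ 0}`. -/
def Om (Ω : Set (En n)) (u : En n → ℝ) : Set (En n) := interior {x ∈ Ω | u x ≤ 0}

/-- The free boundary `F(u) = ∂Ω⁺(u) ∩ Ω`. -/
def FB (Ω : Set (En n)) (u : En n → ℝ) : Set (En n) := frontier (Op Ω u) ∩ Ω

/-- `φ` touches `u` by below at `x₀`. -/
def TouchesBelowAt (φ u : En n → ℝ) (x₀ : En n) : Prop :=
  u x₀ = φ x₀ ∧ ∀ᶠ x in 𝓝 x₀, φ x ≤ u x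

/-- `φ` touches `u` by above at `x₀`. -/
def TouchesAboveAt (φ u : En n → ℝ) (x₀ : En n) : Prop :=
  u x₀ = φ x₀ ∧ ∀ᶠ x in 𝓝 x₀, u x ≤ φ x

/-- `φ` touches `u` strictly by below at `x₀`. -/
def TouchesStrictlyBelowAt (φ u : En n → ℝ) (x₀ : En n) : Prop :=
  u x₀ = φ x₀ ∧ ∀ᶠ x in 𝓝[≠] x₀, φ x < u x

/-- `φ` touches `u` strictly by above at `x₀`. -/
def TouchesStrictlyAboveAt (φ u : En n → ℝ) (x₀ : En n) : Prop :=
  u x₀ = φ x₀ ∧ ∀ᶠ x in 𝓝[≠] x₀, u x < φ x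

/-- `Lop u ≥ f` on `S` in the viscosity sense. -/
def ViscGE (Lop : (En n → ℝ) → En n → ℝ) (S : Set (En n)) (f u : En n → ℝ) : Prop :=
  ∀ x₀ ∈ S, ∀ φ : En n → ℝ, ContDiff ℝ 2 φ → TouchesAboveAt φ u x₀ → f x₀ ≤ Lop φ x₀

/-- `Lop u ≤ f` on `S` in the viscosity sense. -/
def ViscLE (Lop : (En n → ℝ) → En n → ℝ) (S : Set (En n)) (f u : En n → ℝ) : Prop :=
  ∀ x₀ ∈ S, ∀ φ : En n → ℝ, ContDiff ℝ 2 φ → TouchesBelowAt φ u x₀ → Lop φ x₀ ≤ f x₀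

/-- `Lop u = f` on `S` in the viscosity sense. -/
def ViscEq (Lop : (En n → ℝ) → En n → ℝ) (S : Set (En n)) (f u : En n → ℝ) : Prop :=
  ViscGE Lop S f u ∧ ViscLE Lop S f u

/-- A strict comparison subsolution for the operator `Lop`, right hand side `f`, and free
boundary condition `cond (v_ν⁺) (v_ν⁻) x` on `F(v)`.  The normal derivatives are encoded
through `C²` extensions `wp, wm` of `v` to the closures of the two phases, with
`v_ν⁺ = ‖∇wp‖` and `v_ν⁻ = ‖∇wm‖` on the free boundary. -/
def IsStrictSub (Lop : (En n → ℝ) → En n → ℝ) (cond : ℝ → ℝ → En n → Prop)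
    (Ω : Set (En n)) (f v : En n → ℝ) : Prop :=
  ContinuousOn v Ω ∧
  ∃ wp wm : En n → ℝ,
    ContDiffOn ℝ 2 wp (closure (Op Ω v)) ∧
    ContDiffOn ℝ 2 wm (closure (Om Ω v)) ∧
    Set.EqOn v wp (closure (Op Ω v)) ∧ Set.EqOn v wm (closure (Om Ω v)) ∧
    (∀ x ∈ Op Ω v, f x < Lop wp x) ∧
    (∀ x ∈ Om Ω v, f x < Lop wm x) ∧
    (∀ x ∈ FB Ω v, cond (‖gradient wp x‖) (‖gradient wm x‖) x)

/-- A strict comparison supersolution (the condition `v_ν⁺ ≠ 0` on `F(v)` is included). -/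
def IsStrictSuper (Lop : (En n → ℝ) → En n → ℝ) (cond : ℝ → ℝ → En n → Prop)
    (Ω : Set (En n)) (f v : En n → ℝ) : Prop :=
  ContinuousOn v Ω ∧
  ∃ wp wm : En n → ℝ,
    ContDiffOn ℝ 2 wp (closure (Op Ω v)) ∧
    ContDiffOn ℝ 2 wm (closure (Om Ω v)) ∧
    Set.EqOn v wp (closure (Op Ω v)) ∧ Set.EqOn v wm (closure (Om Ω v)) ∧
    (∀ x ∈ Op Ω v, Lop wp x < f x) ∧
    (∀ x ∈ Om Ω v, Lop wm x < f x) ∧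
    (∀ x ∈ FB Ω v, cond (‖gradient wp x‖) (‖gradient wm x‖) x ∧ ‖gradient wp x‖ ≠ 0)

/-- Viscosity solution of the two-phase problem (fb):
`Δu = f` in `Ω⁺(u) ∪ Ω⁻(u)`, `(u_ν⁺)² − (u_ν⁻)² = 1` on `F(u)`. -/
def ViscSolFB (Ω : Set (En n)) (f u : En n → ℝ) : Prop :=
  ContinuousOn u Ω ∧
  ViscEq lap (Op Ω u ∪ Om Ω u) f u ∧
  (∀ v : En n → ℝ, IsStrictSub lap (fun p q _ => 1 < p ^ 2 - q ^ 2) Ω f v →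
    ∀ x₀ ∈ FB Ω v, ¬ TouchesBelowAt v u x₀) ∧
  (∀ v : En n → ℝ, IsStrictSuper lap (fun p q _ => p ^ 2 - q ^ 2 < 1) Ω f v →
    ∀ x₀ ∈ FB Ω u, ¬ TouchesAboveAt v u x₀)

/-- Viscosity solution of the problem (fbcv):
`𝓛u = f` in `Ω⁺(u) ∪ Ω⁻(u)`, `u_ν⁺ = G(u_ν⁻, x)` on `F(u)`. -/
def ViscSolFBG (a : En n → Matrix (Fin n) (Fin n) ℝ) (b : En n → En n)
    (G : ℝ → En n → ℝ) (Ω : Set (En n)) (f u : En n → ℝ) : Prop :=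
  ContinuousOn u Ω ∧
  ViscEq (ellOp a b) (Op Ω u ∪ Om Ω u) f u ∧
  (∀ v : En n → ℝ, IsStrictSub (ellOp a b) (fun p q x => G q x < p) Ω f v →
    ∀ x₀ ∈ FB Ω v, ¬ TouchesBelowAt v u x₀) ∧
  (∀ v : En n → ℝ, IsStrictSuper (ellOp a b) (fun p q x => p < G q x) Ω f v →
    ∀ x₀ ∈ FB Ω u, ¬ TouchesAboveAt v u x₀)

/-- The set `S` is, inside `V`, a `C^{1,γ}` hypersurface: near each point of `S ∩ V` it is
the graph, in some unit direction `ν`, of a `C¹` function with `γ`-Hölder gradient. -/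
def IsC1GammaIn (γ : ℝ) (S V : Set (En (n + 1))) : Prop :=
  ∀ x₀ ∈ S ∩ V, ∃ (ν : En (n + 1)) (ρ C : ℝ) (g : En (n + 1) → ℝ),
    ‖ν‖ = 1 ∧ 0 < ρ ∧ ContDiff ℝ 1 g ∧
    (∀ y z : En (n + 1), ‖fderiv ℝ g y - fderiv ℝ g z‖ ≤ C * ‖y - z‖ ^ γ) ∧
    ∀ x ∈ ball x₀ ρ, (x ∈ S ↔ ⟪x - x₀, ν⟫ = g (x - x₀ - ⟪x - x₀, ν⟫ • ν))

/-- The quadratic polynomial `Q(x) = ½ [(dim−1) xₙ² − |x'|²]` (here the dimension is `n+1`). -/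
def Qf (x : En (n + 1)) : ℝ := (1 / 2) * ((n : ℝ) * xN x ^ 2 - ‖xT x‖ ^ 2)

/-- Viscosity solution of the transmission (linearized) problem
`Δũ = 0` in `B_ρ ∩ {xₙ ≠ 0}`, `α̃² (ũₙ)⁺ − β̃² (ũₙ)⁻ = 0` on `B_ρ ∩ {xₙ = 0}`. -/
def ViscTrans (αt βt ρ : ℝ) (u : En (n + 1) → ℝ) : Prop :=
  ContinuousOn u (ball (0 : En (n + 1)) ρ) ∧
  ViscEq lap (ball (0 : En (n + 1)) ρ ∩ {x | xN x ≠ 0}) (fun _ => (0 : ℝ)) u ∧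
  (∀ (A p q B : ℝ) (y : En (n + 1)), 0 < B → xN y = 0 →
    0 < αt ^ 2 * p - βt ^ 2 * q →
    ∀ x₀ ∈ ball (0 : En (n + 1)) ρ, xN x₀ = 0 →
      ¬ TouchesStrictlyBelowAt
        (fun x => A + p * pos (xN x) - q * neg (xN x) + B * Qf (x - y)) u x₀) ∧
  (∀ (A p q B : ℝ) (y : En (n + 1)), 0 < B → xN y = 0 →
    αt ^ 2 * p - βt ^ 2 * q < 0 →
    ∀ x₀ ∈ ball (0 : En (n + 1)) ρ, xN x₀ = 0 →
      ¬ TouchesStrictlyAboveAt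
        (fun x => A + p * pos (xN x) - q * neg (xN x) + B * Qf (x - y)) u x₀)

/-- Classical solution of the transmission problem on the open set `S`:
smooth up to `{xₙ = 0}` on each side, harmonic off `{xₙ = 0}`, and satisfying the
transmission condition `α̃² (vₙ)⁺ − β̃² (vₙ)⁻ = 0` pointwise on `S ∩ {xₙ = 0}`,
where `(vₙ)±` are the one-sided vertical derivatives. -/
def ClassicalTrans (αt βt : ℝ) (S : Set (En (n + 1))) (v : En (n + 1) → ℝ) : Prop :=
  ContDiffOn ℝ (⊤ : ℕ∞) v (S ∩ {x | 0 ≤ xN x}) ∧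
  ContDiffOn ℝ (⊤ : ℕ∞) v (S ∩ {x | xN x ≤ 0}) ∧
  (∀ x ∈ S, xN x ≠ 0 → lap v x = 0) ∧
  (∀ x ∈ S, xN x = 0 → ∃ dp dm : ℝ,
    HasDerivWithinAt (fun t : ℝ => v (x + t • eN n)) dp (Ici (0 : ℝ)) 0 ∧
    HasDerivWithinAt (fun t : ℝ => v (x + t • eN n)) dm (Iic (0 : ℝ)) 0 ∧
    αt ^ 2 * dp - βt ^ 2 * dm = 0)


/-- The slope of `U β` is at least `β`. -/
theorem U_add_le {β s : ℝ} (hβ : 0 ≤ β) (hs : 0 ≤ s) (t : ℝ) :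
    U β t + β * s ≤ U β (t + s) := by
  have hα : β ≤ Real.sqrt (1 + β ^ 2) := Real.le_sqrt_of_sq_le (by linarith)
  have hpos : pos t ≤ pos (t + s) := max_le_max (by linarith) le_rfl
  have h₁ : pos t - neg t = t := max_zero_sub_eq_self t
  have h₂ : pos (t + s) - neg (t + s) = t + s := max_zero_sub_eq_self (t + s)
  unfold U
  nlinarith [mul_nonneg (sub_nonneg.2 hα) (sub_nonneg.2 hpos)]

theorem U_of_nonneg {β t : ℝ} (ht : 0 ≤ t) : U β t = Real.sqrt (1 + β ^ 2) * t := by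
  simp [U, pos, neg, ht]

theorem U_of_nonpos {β t : ℝ} (ht : t ≤ 0) : U β t = β * t := by
  simp [U, pos, neg, ht]

/-- Lemma 2.9, elementary dichotomy lemma. -/
theorem elementary_dichotomy (n : ℕ) (L : ℝ) (hL : 0 < L) :
    ∃ η₀ > (0 : ℝ), ∀ (u : En (n + 1) → ℝ) (β η : ℝ),
      ContinuousOn u (ball (0 : En (n + 1)) 2) →
      0 ≤ β → β ≤ L → 0 < η → η ≤ η₀ →
      (∀ x ∈ ball (0 : En (n + 1)) 2, |u x - U β (xN x)| ≤ η) →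
      (∀ x ∈ ball (0 : En (n + 1)) 2, xN x ≤ -η → u x ≤ 0) →
      (∀ x ∈ ball (0 : En (n + 1)) 2, u x ≤ 0 → xN x ≤ η) →
      ((η ^ ((1 : ℝ) / 3) ≤ β →
        ∀ x ∈ ball (0 : En (n + 1)) 1,
          U β (xN x - η ^ ((1 : ℝ) / 3)) ≤ u x ∧ u x ≤ U β (xN x + η ^ ((1 : ℝ) / 3))) ∧
       (β < η ^ ((1 : ℝ) / 3) →
        ∀ x ∈ ball (0 : En (n + 1)) 1,
          pos (xN x - η ^ ((1 : ℝ) / 3)) ≤ pos (u x) ∧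
            pos (u x) ≤ pos (xN x + η ^ ((1 : ℝ) / 3)))) := by
  refine ⟨1 / 8, by norm_num, fun u β η _ hβ _ hη hη₀ hflat hneg _ => ?_⟩
  obtain ⟨s, hs⟩ : ∃ s, s = η ^ ((1 : ℝ) / 3) := ⟨_, rfl⟩
  rw [← hs]
  have hs0 : 0 < s := hs ▸ Real.rpow_pos_of_pos hη _
  have hs3 : s ^ 3 = η := by
    rw [hs, ← Real.rpow_natCast, ← Real.rpow_mul hη.le]
    norm_num
  have hs2 : s ≤ 1 / 2 :=
    le_of_pow_le_pow_left₀ three_ne_zero (by norm_num) (by rw [hs3]; linarith)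
  have hηs : η ≤ s / 4 := by nlinarith [mul_nonneg hs0.le (sub_nonneg.2 hs2)]
  refine ⟨fun hsβ x hx => ?_, fun hβs x hx => ?_⟩ <;>
    have hx2 := ball_subset_ball (by norm_num : (1 : ℝ) ≤ 2) hx <;>
    obtain ⟨hl, hu⟩ := abs_le.1 (hflat x hx2)
  · have hηβ : η ≤ β * s := by nlinarith [mul_le_mul_of_nonneg_right hsβ hs0.le]
    have hlow := U_add_le hβ hs0.le (xN x - s)
    have hupp := U_add_le hβ hs0.le (xN x)
    rw [sub_add_cancel] at hlow
    constructor <;> linarith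
  · have hα : 1 ≤ Real.sqrt (1 + β ^ 2) := Real.one_le_sqrt.2 (by nlinarith)
    have hα' : Real.sqrt (1 + β ^ 2) ≤ 1 + s / 2 :=
      Real.sqrt_le_iff.2 ⟨by linarith, by nlinarith⟩
    have hx1 : xN x ≤ 1 :=
      (le_abs_self _).trans ((PiLp.norm_apply_le x _).trans (mem_ball_zero_iff.1 hx).le)
    constructor
    · refine max_le ?_ (le_max_right _ _)
      rcases le_total (xN x) s with h | h
      · exact (sub_nonpos.2 h).trans (le_max_right _ _)
      · refine le_trans ?_ (le_max_left _ _)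
        rw [U_of_nonneg (hs0.le.trans h)] at hl
        nlinarith
    · refine max_le ?_ (le_max_right _ _)
      rcases le_total (xN x) (-η) with h | h
      · exact (hneg x hx2 h).trans (le_max_right _ _)
      · refine le_trans ?_ (le_max_left _ _)
        rcases le_total 0 (xN x) with h0 | h0
        · rw [U_of_nonneg h0] at hu
          nlinarith
        · rw [U_of_nonpos h0] at hu
          nlinarith [mul_nonneg hβ (neg_nonneg.2 h0)]

end TwoPhase
end
end

section
/- Fix constants α̃ > 0 and β̃ ≥ 0, and let h be a continuous function on ∂B₁ ⊂ ℝⁿ. There exists a unique classical solution ṽ of the transmission problem with boundary data h: ṽ is continuous on the closed ball, ṽ = h on ∂B₁, ṽ ∈ C^∞(B₁ ∩ {xₙ ≥ 0}) ∩ C^∞(B₁ ∩ {xₙ ≤ 0}), ṽ is harmonic in B₁ ∩ {xₙ ≠ 0}, and α̃²(ṽₙ)⁺ − β̃²(ṽₙ)⁻ = 0 pointwise on B₁ ∩ {xₙ = 0}. Moreover there exists a constant C̃ depending only on n, α̃, β̃ such that for every x̄ = (x̄′, 0) ∈ B_{1/2} and every 0 < r ≤ 1/4, there are p̃(x̄),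 q̃(x̄) with α̃²p̃(x̄) − β̃²q̃(x̄) = 0 and |ṽ(x) − ṽ(x̄) − (∇_{x′}ṽ(x̄)·(x′ − x̄′) + p̃(x̄)(xₙ)⁺ − q̃(x̄)(xₙ)⁻)| ≤ C̃ ‖ṽ‖_{L∞} r² for all x ∈ B_r(x̄). -/
open Metric Set Filter
open scoped RealInnerProductSpace NNReal Topology Classical

noncomputable section

namespace TwoPhase

variable {n : ℕ}

open MeasureTheory in
theorem hasFDerivAt_integral_smul_of_contDiffOn {E F : Type} [NormedAddCommGroup E]
    [NormedSpace ℝ E] [FiniteDimensional ℝ E] [MeasurableSpace E] [BorelSpace E]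
    [NormedAddCommGroup F] [NormedSpace ℝ F] {W : Set (E × E)} (hW : IsOpen W) {H : E × E → F}
    (hH : ContDiffOn ℝ 1 H W) {K : Set E} (hK : IsCompact K) {x₀ : E}
    (hx₀ : ∀ y ∈ K, (x₀, y) ∈ W) {g : E → ℝ} (hg : ContinuousOn g K)
    (μ : Measure E) [IsFiniteMeasure μ] :
    HasFDerivAt (fun x => ∫ y in K, g y • H (x, y) ∂μ)
      (∫ y in K, g y • (fderiv ℝ H (x₀, y)).comp (ContinuousLinearMap.inl ℝ E E) ∂μ) x₀ := by
  have : ProperSpace E := FiniteDimensional.proper ℝ E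
  obtain ⟨u, v, hu, hv, hxu, hKv, huv⟩ := generalized_tube_lemma (isCompact_singleton (x := x₀)) hK
    hW (by rintro ⟨a, b⟩ ⟨ha, hb⟩; obtain rfl : a = x₀ := ha; exact hx₀ b hb)
  obtain ⟨δ, hδ, hδu⟩ := Metric.nhds_basis_closedBall.mem_iff.1
    (hu.mem_nhds (hxu (mem_singleton x₀)))
  have hsub : closedBall x₀ δ ×ˢ K ⊆ W := (prod_mono hδu hKv).trans huv
  have hD : ContinuousOn (fun p : E × E =>
      g p.2 • (fderiv ℝ H p).comp (ContinuousLinearMap.inl ℝ E E)) (closedBall x₀ δ ×ˢ K) := by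
    refine (hg.comp continuousOn_snd fun p hp => hp.2).smul ?_
    exact ((hH.continuousOn_fderiv_of_isOpen hW le_rfl).mono hsub).clm_comp continuousOn_const
  have hC : ∀ x ∈ closedBall x₀ δ, ContinuousOn (fun y => g y • H (x, y)) K := fun x hx =>
    hg.smul (hH.continuousOn.comp (by fun_prop) fun y hy => hsub ⟨hx, hy⟩)
  obtain ⟨B, hB⟩ := ((isCompact_closedBall x₀ δ).prod hK).exists_bound_of_continuousOn hD
  have hx₀δ : x₀ ∈ closedBall x₀ δ := mem_closedBall_self hδ.le
  refine hasFDerivAt_integral_of_dominated_of_fderiv_le (bound := fun _ => B)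
    (F' := fun x y => g y • (fderiv ℝ H (x, y)).comp (ContinuousLinearMap.inl ℝ E E))
    (closedBall_mem_nhds x₀ hδ) ?_ ?_ ?_ ?_ (integrable_const B) ?_
  · filter_upwards [closedBall_mem_nhds x₀ hδ] with x hx
    exact ((hC x hx).integrableOn_compact hK).aestronglyMeasurable
  · exact (hC x₀ hx₀δ).integrableOn_compact hK
  · refine (ContinuousOn.integrableOn_compact hK ?_).aestronglyMeasurable
    exact hD.comp (f := fun y => (x₀, y)) (by fun_prop) fun y hy => ⟨hx₀δ, hy⟩
  · filter_upwards [ae_restrict_mem hK.measurableSet] with y hy x hx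
    exact hB (x, y) ⟨hx, hy⟩
  · filter_upwards [ae_restrict_mem hK.measurableSet] with y hy x hx
    have h1 : HasFDerivAt H (fderiv ℝ H (x, y)) (x, y) :=
      ((hH.contDiffAt (hW.mem_nhds (hsub ⟨hx, hy⟩))).differentiableAt (by simp)).hasFDerivAt
    exact (h1.comp x (hasFDerivAt_prodMk_left x y)).const_smul (g y)

/-- The derivative of a function of two variables in the first one. -/
def partialFst {E F : Type} [NormedAddCommGroup E] [NormedSpace ℝ E] [NormedAddCommGroup F]
    [NormedSpace ℝ F] (H : E × E → F) (p : E × E) : E →L[ℝ] F :=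
  (fderiv ℝ H p).comp (ContinuousLinearMap.inl ℝ E E)

theorem contDiffOn_partialFst {E F : Type} [NormedAddCommGroup E] [NormedSpace ℝ E]
    [NormedAddCommGroup F] [NormedSpace ℝ F] {W : Set (E × E)} (hW : IsOpen W) {H : E × E → F}
    (hH : ContDiffOn ℝ (⊤ : ℕ∞) H W) : ContDiffOn ℝ (⊤ : ℕ∞) (partialFst H) W :=
  (hH.fderiv_of_isOpen hW (by simp)).clm_comp contDiffOn_const

theorem hasFDerivAt_partialFst {E F : Type} [NormedAddCommGroup E] [NormedSpace ℝ E]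
    [NormedAddCommGroup F] [NormedSpace ℝ F] {W : Set (E × E)} (hW : IsOpen W) {H : E × E → F}
    (hH : ContDiffOn ℝ (⊤ : ℕ∞) H W) {x y : E} (h : (x, y) ∈ W) :
    HasFDerivAt (fun z => H (z, y)) (partialFst H (x, y)) x := by
  have h1 : HasFDerivAt H (fderiv ℝ H (x, y)) (x, y) :=
    ((hH.contDiffAt (hW.mem_nhds h)).differentiableAt (by simp)).hasFDerivAt
  exact h1.comp x (hasFDerivAt_prodMk_left x y)

open MeasureTheory in
theorem contDiffOn_integral_smul {E : Type} [NormedAddCommGroup E]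
    [NormedSpace ℝ E] [FiniteDimensional ℝ E] [MeasurableSpace E] [BorelSpace E]
    {W : Set (E × E)} (hW : IsOpen W) {K : Set E} (hK : IsCompact K) {V : Set E} (hV : IsOpen V)
    (hVW : V ×ˢ K ⊆ W) {g : E → ℝ} (hg : ContinuousOn g K) (μ : Measure E) [IsFiniteMeasure μ]
    {F : Type} [NormedAddCommGroup F] [NormedSpace ℝ F] {H : E × E → F}
    (hH : ContDiffOn ℝ (⊤ : ℕ∞) H W) :
    ContDiffOn ℝ (⊤ : ℕ∞) (fun x => ∫ y in K, g y • H (x, y) ∂μ) V := by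
  have key : ∀ k : ℕ, ∀ (F : Type) [NormedAddCommGroup F] [NormedSpace ℝ F] (H : E × E → F),
      ContDiffOn ℝ (⊤ : ℕ∞) H W →
      ContDiffOn ℝ k (fun x => ∫ y in K, g y • H (x, y) ∂μ) V := by
    intro k
    induction k with
    | zero =>
      intro F _ _ H hH
      refine contDiffOn_zero.2 fun x hx => ContinuousAt.continuousWithinAt ?_
      exact (hasFDerivAt_integral_smul_of_contDiffOn hW (hH.of_le (by simp)) hK
        (fun y hy => hVW ⟨hx, hy⟩) hg μ).continuousAt
    | succ k ih =>
      intro F _ _ H hH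
      have hder : ∀ x ∈ V, HasFDerivAt (fun x => ∫ y in K, g y • H (x, y) ∂μ)
          (∫ y in K, g y • partialFst H (x, y) ∂μ) x := fun x hx =>
        hasFDerivAt_integral_smul_of_contDiffOn hW (hH.of_le (by simp)) hK
          (fun y hy => hVW ⟨hx, hy⟩) hg μ
      push_cast
      refine (contDiffOn_succ_iff_fderiv_of_isOpen hV).2
        ⟨fun x hx => (hder x hx).differentiableAt.differentiableWithinAt, by simp, ?_⟩
      exact (ih _ _ (contDiffOn_partialFst hW hH)).congr fun x hx => (hder x hx).fderiv
  exact contDiffOn_infty.2 fun k => key k F H hH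

theorem lap_eq_sum_of_hasFDerivAt {f : En n → ℝ} {f' : En n → En n →L[ℝ] ℝ}
    {f'' : Fin n → En n →L[ℝ] ℝ} {x : En n} (h : ∀ᶠ y in 𝓝 x, HasFDerivAt f (f' y) y)
    (h' : ∀ i, HasFDerivAt (fun y => f' y (EuclideanSpace.single i 1)) (f'' i) x) :
    lap f x = ∑ i, f'' i (EuclideanSpace.single i 1) := by
  refine Finset.sum_congr rfl fun i _ => ?_
  have : (fun y => fderiv ℝ f y (EuclideanSpace.single i 1)) =ᶠ[𝓝 x]
      fun y => f' y (EuclideanSpace.single i 1) := by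
    filter_upwards [h] with y hy
    rw [hy.fderiv]
  rw [this.fderiv_eq, (h' i).fderiv]

theorem eventually_hasFDerivAt {f : En n → ℝ} {x : En n} (hf : ContDiffAt ℝ 2 f x) :
    ∀ᶠ y in 𝓝 x, HasFDerivAt f (fderiv ℝ f y) y := by
  filter_upwards [hf.eventually (by simp)] with y hy
  exact (hy.differentiableAt (by simp)).hasFDerivAt

theorem hasFDerivAt_fderiv_apply {f : En n → ℝ} {x : En n} (hf : ContDiffAt ℝ 2 f x) (e : En n) :
    HasFDerivAt (fun y => fderiv ℝ f y e) (fderiv ℝ (fun y => fderiv ℝ f y e) x) x := by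
  have h1 : ContDiffAt ℝ 1 (fderiv ℝ f) x := hf.fderiv_right (by norm_num)
  exact ((h1.differentiableAt (by simp)).clm_apply (differentiableAt_const e)).hasFDerivAt

theorem lap_add_const_mul {f g : En n → ℝ} {x : En n} (hf : ContDiffAt ℝ 2 f x)
    (hg : ContDiffAt ℝ 2 g x) (c : ℝ) :
    lap (fun y => f y + c * g y) x = lap f x + c * lap g x := by
  have := lap_eq_sum_of_hasFDerivAt (f := fun y => f y + c * g y)
    (f' := fun y => fderiv ℝ f y + c • fderiv ℝ g y)
    (f'' := fun i => fderiv ℝ (fun y => fderiv ℝ f y (EuclideanSpace.single i 1)) x +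
      c • fderiv ℝ (fun y => fderiv ℝ g y (EuclideanSpace.single i 1)) x) (x := x) ?_ ?_
  · simpa [lap, Finset.sum_add_distrib, Finset.mul_sum] using this
  · filter_upwards [eventually_hasFDerivAt hf, eventually_hasFDerivAt hg] with y h1 h2
    exact h1.add (h2.const_mul c)
  · intro i
    exact (hasFDerivAt_fderiv_apply hf _).add ((hasFDerivAt_fderiv_apply hg _).const_mul c)

theorem fderiv_fderiv_nonpos_of_isLocalMax {f : En n → ℝ} {x : En n} (hf : ContDiffAt ℝ 2 f x)
    (hmax : IsLocalMax f x) (e : En n) : fderiv ℝ (fun y => fderiv ℝ f y e) x e ≤ 0 := by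
  by_contra! hc
  set c := fderiv ℝ (fun y => fderiv ℝ f y e) x e with hcdef
  have hline : ∀ t : ℝ, HasDerivAt (fun s : ℝ => x + s • e) e t := fun t => by
    simpa using ((hasDerivAt_id t).smul_const e).const_add x
  have hline0 : Tendsto (fun s : ℝ => x + s • e) (𝓝 0) (𝓝 x) := by
    have := (hline 0).continuousAt.tendsto
    simpa using this
  set G : ℝ → ℝ := fun t => f (x + t • e) - c / 4 * t ^ 2 with hG
  have hG1 : ∀ᶠ t in 𝓝 (0 : ℝ), HasDerivAt G (fderiv ℝ f (x + t • e) e - c / 2 * t) t := by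
    filter_upwards [hline0.eventually (eventually_hasFDerivAt hf)] with t ht
    have := (ht.comp_hasDerivAt t (hline t)).sub (((hasDerivAt_id t).pow 2).const_mul (c / 4))
    refine this.congr_deriv ?_
    simp only [id_eq, Nat.cast_ofNat]
    ring
  have hG2 : HasDerivAt (deriv G) (c / 2) 0 := by
    have h1 := hasFDerivAt_fderiv_apply hf e
    have h2 : HasDerivAt (fun t : ℝ => fderiv ℝ f (x + t • e) e) c 0 := by
      have h3 : x = x + (0 : ℝ) • e := by simp
      have := HasFDerivAt.comp_hasDerivAt (0 : ℝ) (h3 ▸ h1) (hline 0)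
      exact this.congr_deriv (by simp [hcdef])
    have h3 := h2.sub ((hasDerivAt_id (0 : ℝ)).const_mul (c / 2))
    have h4 : deriv G =ᶠ[𝓝 0] fun t => fderiv ℝ f (x + t • e) e - c / 2 * t := by
      filter_upwards [hG1] with t ht
      exact ht.deriv
    exact (h3.congr_deriv (by ring)).congr_of_eventuallyEq h4
  have hG0 : deriv G 0 = 0 := by
    rw [hG1.self_of_nhds.deriv]
    simp [hmax.fderiv_eq_zero]
  have hmin := isLocalMin_of_deriv_deriv_pos (f := G) (x₀ := 0) (by rw [hG2.deriv]; linarith) hG0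
    hG1.self_of_nhds.continuousAt
  have hfalse : ∀ᶠ t in 𝓝[≠] (0 : ℝ), False := by
    filter_upwards [hmin.filter_mono nhdsWithin_le_nhds,
      (hline0.eventually hmax).filter_mono nhdsWithin_le_nhds, self_mem_nhdsWithin] with t h1 h2 h3
    have : 0 < t ^ 2 := by have : t ≠ 0 := h3; positivity
    simp only [hG, zero_smul, add_zero] at h1
    nlinarith
  exact hfalse.exists.elim fun _ h => h

theorem lap_nonpos_of_isLocalMax {f : En n → ℝ} {x : En n} (hf : ContDiffAt ℝ 2 f x)
    (hmax : IsLocalMax f x) : lap f x ≤ 0 :=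
  Finset.sum_nonpos fun _ _ => fderiv_fderiv_nonpos_of_isLocalMax hf hmax _

/-- The vertical coordinate as a continuous linear map. -/
def xNL (n : ℕ) : En (n + 1) →L[ℝ] ℝ := EuclideanSpace.proj (Fin.last n)

theorem continuous_xN : Continuous (xN : En (n + 1) → ℝ) := (xNL n).continuous

theorem xN_add_smul_eN (x : En (n + 1)) (t : ℝ) : xN (x + t • eN n) = xN x + t := by
  simp [xN, eN]

theorem abs_xN_le (x : En (n + 1)) : |xN x| ≤ ‖x‖ := by
  simpa [xN] using PiLp.norm_apply_le x (Fin.last n)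

theorem lap_xN_profile (s : ℝ) (x : En (n + 1)) :
    lap (fun y : En (n + 1) => s * xN y + xN y ^ 2) x = 2 := by
  have := lap_eq_sum_of_hasFDerivAt (f := fun y : En (n + 1) => s * xN y + xN y ^ 2)
    (f' := fun y => s • xNL n + (2 * xN y) • xNL n)
    (f'' := fun i => (2 * xNL n (EuclideanSpace.single i 1)) • xNL n) (x := x)
    (Eventually.of_forall fun y => ?_) ?_
  · rw [this]
    simp [xNL, Fin.sum_univ_castSucc, (Fin.castSucc_ne_last _).symm]
  · have h : HasFDerivAt (xN : En (n + 1) → ℝ) (xNL n) y := (xNL n).hasFDerivAt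
    refine ((h.const_mul s).add (h.pow 2)).congr_fderiv ?_
    ext z; simp
  · intro i
    have h : HasFDerivAt (xN : En (n + 1) → ℝ) (xNL n) x := (xNL n).hasFDerivAt
    have h2 := (h.const_mul (2 * xNL n (EuclideanSpace.single i 1))).const_add
      (s * xNL n (EuclideanSpace.single i 1))
    refine h2.congr_of_eventuallyEq (Eventually.of_forall fun y => ?_)
    simp; ring

theorem one_sided_deriv_nonpos_of_isLocalMax {f : ℝ → ℝ} {dp dm : ℝ} (hmax : IsLocalMax f 0)
    (hp : HasDerivWithinAt f dp (Ici 0) 0) (hm : HasDerivWithinAt f dm (Iic 0) 0) :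
    dp ≤ 0 ∧ 0 ≤ dm := by
  constructor
  · have := (hmax.on (Ici 0)).hasFDerivWithinAt_nonpos hp.hasFDerivWithinAt (y := 1)
      (mem_posTangentConeAt_of_segment_subset (by
        rw [zero_add, segment_eq_Icc zero_le_one]; exact Icc_subset_Ici_self))
    simpa using this
  · have := (hmax.on (Iic 0)).hasFDerivWithinAt_nonpos hm.hasFDerivWithinAt (y := -1)
      (mem_posTangentConeAt_of_segment_subset (by
        rw [zero_add, segment_symm, segment_eq_Icc (by norm_num)]; exact Icc_subset_Iic_self))
    simpa using this

theorem nonpos_of_transmission {α β R : ℝ} (hα : 0 < α) {w : En (n + 1) → ℝ}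
    (hw : ContinuousOn w (closedBall 0 R)) (hb : ∀ x ∈ sphere (0 : En (n + 1)) R, w x ≤ 0)
    (hlap : ∀ x ∈ ball (0 : En (n + 1)) R, xN x ≠ 0 → ContDiffAt ℝ 2 w x ∧ lap w x = 0)
    (htr : ∀ x ∈ ball (0 : En (n + 1)) R, xN x = 0 → ∃ dp dm : ℝ,
      HasDerivWithinAt (fun t : ℝ => w (x + t • eN n)) dp (Ici (0 : ℝ)) 0 ∧
      HasDerivWithinAt (fun t : ℝ => w (x + t • eN n)) dm (Iic (0 : ℝ)) 0 ∧
      α ^ 2 * dp - β ^ 2 * dm = 0) :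
    ∀ x ∈ closedBall (0 : En (n + 1)) R, w x ≤ 0 := by
  intro x hx
  have key : ∀ ε > 0, w x ≤ ε * (R + R ^ 2) := by
    intro ε hε
    set W : En (n + 1) → ℝ := fun y => w y + ε * (|xN y| + xN y ^ 2) with hWdef
    have hWc : ContinuousOn W (closedBall 0 R) :=
      hw.add (Continuous.continuousOn (by have := continuous_xN (n := n); fun_prop))
    obtain ⟨x₀, hx₀, hmax⟩ := (isCompact_closedBall (0 : En (n + 1)) R).exists_isMaxOn
      ⟨x, hx⟩ hWc
    have hwW : w x ≤ W x₀ := le_trans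
      (by simp only [hWdef]; linarith [show 0 ≤ ε * (|xN x| + xN x ^ 2) by positivity]) (hmax hx)
    by_cases hs : x₀ ∈ sphere (0 : En (n + 1)) R
    · have h1 := hb x₀ hs
      have h2 : |xN x₀| ≤ R := (abs_xN_le x₀).trans (by simpa using hx₀)
      have h3 : xN x₀ ^ 2 ≤ R ^ 2 := sq_le_sq' (by linarith [neg_abs_le (xN x₀)])
        ((le_abs_self _).trans h2)
      calc w x ≤ W x₀ := hwW
        _ ≤ 0 + ε * (R + R ^ 2) := by simp only [hWdef]; gcongr
        _ = _ := by ring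
    · exfalso
      have hball : x₀ ∈ ball (0 : En (n + 1)) R := by
        simp only [mem_sphere, mem_ball, mem_closedBall] at *
        exact lt_of_le_of_ne hx₀ hs
      have hloc : IsLocalMax W x₀ := hmax.isLocalMax
        (mem_of_superset (isOpen_ball.mem_nhds hball) ball_subset_closedBall)
      by_cases hN : xN x₀ = 0
      · obtain ⟨dp, dm, hp, hm, heq⟩ := htr x₀ hball hN
        have hl : IsLocalMax (fun t : ℝ => W (x₀ + t • eN n)) 0 := by
          have : Tendsto (fun t : ℝ => x₀ + t • eN n) (𝓝 0) (𝓝 x₀) := by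
            have : Continuous fun t : ℝ => x₀ + t • eN n := by fun_prop
            simpa using this.tendsto 0
          simpa [IsLocalMax, IsMaxFilter] using this.eventually hloc
        have hq : HasDerivAt (fun t : ℝ => t ^ 2) 0 0 := by
          simpa using hasDerivAt_pow 2 (0 : ℝ)
        have hp' : HasDerivWithinAt (fun t : ℝ => W (x₀ + t • eN n)) (dp + ε * (1 + 0))
            (Ici 0) 0 := by
          refine (hp.add (((hasDerivAt_id (0 : ℝ)).add hq).hasDerivWithinAt.const_mul ε)).congr
            (fun t ht => ?_) ?_
          · simp [hWdef, xN_add_smul_eN, hN, abs_of_nonneg (mem_Ici.1 ht)]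
          · simp [hWdef, hN]
        have hm' : HasDerivWithinAt (fun t : ℝ => W (x₀ + t • eN n)) (dm + ε * (-1 + 0))
            (Iic 0) 0 := by
          refine (hm.add (((hasDerivAt_id (0 : ℝ)).neg.add hq).hasDerivWithinAt.const_mul ε)).congr
            (fun t ht => ?_) ?_
          · simp [hWdef, xN_add_smul_eN, hN, abs_of_nonpos (mem_Iic.1 ht)]
          · simp [hWdef, hN]
        obtain ⟨h1, h2⟩ := one_sided_deriv_nonpos_of_isLocalMax hl hp' hm'
        have h3 : α ^ 2 * (dp + ε) ≤ 0 :=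
          mul_nonpos_of_nonneg_of_nonpos (by positivity) (by linarith)
        have h4 : 0 ≤ β ^ 2 * (dm - ε) := mul_nonneg (by positivity) (by linarith)
        have h5 : 0 < α ^ 2 * ε := by positivity
        have h6 : 0 ≤ β ^ 2 * ε := by positivity
        linarith
      · obtain ⟨hc, hl0⟩ := hlap x₀ hball hN
        obtain ⟨s, hs⟩ : ∃ s : ℝ, ∀ᶠ y in 𝓝 x₀, |xN y| = s * xN y := by
          rcases lt_or_gt_of_ne hN with h | h
          · refine ⟨-1, ?_⟩
            filter_upwards [continuous_xN.continuousAt.eventually_lt_const h] with y hy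
            rw [abs_of_neg hy]; ring
          · refine ⟨1, ?_⟩
            filter_upwards [continuous_xN.continuousAt.eventually_const_lt h] with y hy
            rw [abs_of_pos hy]; ring
        have hev : W =ᶠ[𝓝 x₀] fun y => w y + ε * (s * xN y + xN y ^ 2) := by
          filter_upwards [hs] with y hy
          simp only [hWdef, hy]
        have hxN : ContDiffAt ℝ 2 (xN : En (n + 1) → ℝ) x₀ := (xNL n).contDiff.contDiffAt
        have hφ : ContDiffAt ℝ 2 (fun y : En (n + 1) => s * xN y + xN y ^ 2) x₀ :=
          (contDiffAt_const.mul hxN).add (hxN.pow 2)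
        have h1 := lap_nonpos_of_isLocalMax (hc.add (contDiffAt_const.mul hφ))
          (hloc.congr hev)
        have h2 := lap_add_const_mul hc hφ ε
        rw [hl0, lap_xN_profile] at h2
        have h3 : lap (fun y => w y + ε * (s * xN y + xN y ^ 2)) x₀ ≤ 0 := h1
        linarith
  have hlim : Tendsto (fun ε : ℝ => ε * (R + R ^ 2)) (𝓝[>] 0) (𝓝 0) := by
    have : Continuous fun ε : ℝ => ε * (R + R ^ 2) := by fun_prop
    simpa using (this.tendsto 0).mono_left nhdsWithin_le_nhds
  exact ge_of_tendsto hlim (eventually_nhdsWithin_of_forall fun ε hε => key ε hε)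

open MeasureTheory in
theorem exists_invariant_probability_sphere (n : ℕ) :
    ∃ σ : Measure (En (n + 1)), IsProbabilityMeasure σ ∧
      (∀ᵐ x ∂σ, x ∈ sphere (0 : En (n + 1)) 1) ∧
      ∀ R : En (n + 1) ≃ₗᵢ[ℝ] En (n + 1), MeasurePreserving R σ σ := by
  set B : Set (En (n + 1)) := ball 0 1
  set ν : Measure (En (n + 1)) := (volume B)⁻¹ • volume.restrict B with hν
  set N : En (n + 1) → En (n + 1) := fun y => ‖y‖⁻¹ • y
  have hN : Measurable N := measurable_norm.inv.smul measurable_id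
  have hB0 : volume B ≠ 0 := (measure_ball_pos volume 0 one_pos).ne'
  have hBt : volume B ≠ ⊤ := measure_ball_lt_top.ne
  have hνp : IsProbabilityMeasure ν := ⟨by
    simp [hν, ENNReal.inv_mul_cancel hB0 hBt]⟩
  refine ⟨ν.map N, Measure.isProbabilityMeasure_map hN.aemeasurable, ?_, fun R => ?_⟩
  · rw [ae_map_iff (p := fun x => x ∈ sphere (0 : En (n + 1)) 1) hN.aemeasurable
      isClosed_sphere.measurableSet]
    refine Measure.ae_smul_measure (ae_restrict_of_ae ?_) _
    have : ∀ᵐ x : En (n + 1), x ≠ 0 := by simp [ae_iff]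
    filter_upwards [this] with x hx
    simp [N, norm_smul, hx]
  · have hRB : R ⁻¹' B = B := by ext x; simp [B]
    have h1 : MeasurePreserving R ν ν := by
      have := (R.measurePreserving.restrict_preimage (s := B) isOpen_ball.measurableSet)
      rw [hRB] at this
      exact this.smul_measure _
    refine ⟨R.continuous.measurable, ?_⟩
    have h2 : R ∘ N = N ∘ R := by
      ext x; simp [N]
    rw [Measure.map_map R.continuous.measurable hN, h2, ← Measure.map_map hN
      R.continuous.measurable, h1.map_eq]

/-- The Poisson kernel of the unit ball, up to normalisation. -/
def poissonKernel (p : En (n + 1) × En (n + 1)) : ℝ :=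
  (1 - ‖p.1‖ ^ 2) * (‖p.1 - p.2‖ ^ 2) ^ (-((n : ℝ) + 1) / 2)

theorem isOpen_offDiag (n : ℕ) : IsOpen {p : En (n + 1) × En (n + 1) | p.1 ≠ p.2} :=
  isOpen_ne_fun continuous_fst continuous_snd

theorem contDiffOn_poissonKernel :
    ContDiffOn ℝ (⊤ : ℕ∞) (poissonKernel (n := n)) {p | p.1 ≠ p.2} := by
  intro p hp
  refine ContDiffAt.contDiffWithinAt ?_
  refine (contDiffAt_const.sub (contDiffAt_fst.norm_sq ℝ)).mul
    (((contDiffAt_fst.sub contDiffAt_snd).norm_sq ℝ).rpow_const_of_ne ?_)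
  have : p.1 - p.2 ≠ 0 := sub_ne_zero.2 hp
  positivity

theorem sum_mul_eq_inner (x y : En (n + 1)) : ∑ i, x i * y i = ⟪x, y⟫ := by
  simp [PiLp.inner_apply, mul_comm]

theorem lap_poissonKernel {x y : En (n + 1)} (hy : ‖y‖ = 1) (hxy : x ≠ y) :
    lap (fun z => poissonKernel (z, y)) x = 0 := by
  set s : ℝ := -((n : ℝ) + 1) / 2 with hs
  have hsq : ∀ z : En (n + 1),
      HasFDerivAt (fun z : En (n + 1) => ‖z - y‖ ^ 2) (2 • innerSL ℝ (z - y)) z := fun z => by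
    simpa using ((hasFDerivAt_id z).sub_const y).norm_sq
  have hN : ∀ z : En (n + 1),
      HasFDerivAt (fun z : En (n + 1) => 1 - ‖z‖ ^ 2) (-(2 • innerSL ℝ z)) z := fun z => by
    simpa using ((hasFDerivAt_id z).norm_sq).const_sub 1
  have hpow : ∀ (z : En (n + 1)) (r : ℝ), z ≠ y →
      HasFDerivAt (fun z : En (n + 1) => (‖z - y‖ ^ 2) ^ r)
        ((r * (‖z - y‖ ^ 2) ^ (r - 1)) • (2 • innerSL ℝ (z - y))) z := fun z r hz => by
    have h0 : z - y ≠ 0 := sub_ne_zero.2 hz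
    exact (hsq z).rpow_const (Or.inl (by positivity))
  have hcoord : ∀ i, HasFDerivAt (fun z : En (n + 1) => z i)
      (EuclideanSpace.proj i : En (n + 1) →L[ℝ] ℝ) x := fun i =>
    (EuclideanSpace.proj i : En (n + 1) →L[ℝ] ℝ).hasFDerivAt
  rw [lap_eq_sum_of_hasFDerivAt (f := fun z => poissonKernel (z, y))
    (f' := fun z => (1 - ‖z‖ ^ 2) • ((s * (‖z - y‖ ^ 2) ^ (s - 1)) • (2 • innerSL ℝ (z - y))) +
      ((‖z - y‖ ^ 2) ^ s) • (-(2 • innerSL ℝ z)))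
    (f'' := fun i =>
      ((1 - ‖x‖ ^ 2) • ((2 * s * (‖x - y‖ ^ 2) ^ (s - 1)) •
          (EuclideanSpace.proj i : En (n + 1) →L[ℝ] ℝ) + (x i - y i) • (2 * s) •
          (((s - 1) * (‖x - y‖ ^ 2) ^ (s - 1 - 1)) • (2 • innerSL ℝ (x - y)))) +
        (2 * s * (‖x - y‖ ^ 2) ^ (s - 1) * (x i - y i)) • (-(2 • innerSL ℝ x))) +
      ((‖x - y‖ ^ 2) ^ s • (-2 : ℝ) • (EuclideanSpace.proj i : En (n + 1) →L[ℝ] ℝ) +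
        (-2 * x i) • ((s * (‖x - y‖ ^ 2) ^ (s - 1)) • (2 • innerSL ℝ (x - y))))) (x := x) ?_ ?_]
  · set ρ : ℝ := ‖x - y‖ ^ 2 with hρ
    have hρ0 : 0 < ρ := by
      have h0 : x - y ≠ 0 := sub_ne_zero.2 hxy
      positivity
    have e1 : ρ ^ (s - 1) = ρ * ρ ^ (s - 1 - 1) := by
      rw [Real.rpow_sub_one hρ0.ne' (s - 1)]; field_simp
    have e2 : ρ ^ s = ρ * ρ ^ (s - 1) := by
      rw [Real.rpow_sub_one hρ0.ne' s]; field_simp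
    have hzz : ∑ i, (x i - y i) * (x i - y i) = ρ := by
      have := sum_mul_eq_inner (x - y) (x - y)
      simpa [hρ] using this
    have hxz : ∑ i, x i * (x i - y i) = ⟪x, x - y⟫ := by
      simpa using sum_mul_eq_inner x (x - y)
    have hrel : 2 * ⟪x, x - y⟫ + (1 - ‖x‖ ^ 2) = ρ := by
      rw [hρ, norm_sub_sq_real, inner_sub_right, real_inner_self_eq_norm_sq, hy]; ring
    set Q := ρ ^ (s - 1 - 1)
    set X := ⟪x, x - y⟫
    set N := 1 - ‖x‖ ^ 2
    have hterm : ∀ i : Fin (n + 1), (N * (2 * s * ρ ^ (s - 1)) - 2 * ρ ^ s) +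
        (N * (4 * s * (s - 1) * Q)) * ((x i - y i) * (x i - y i)) +
        (-8 * s * ρ ^ (s - 1)) * (x i * (x i - y i)) = (N • ((2 * s * ρ ^ (s - 1)) •
          (EuclideanSpace.proj i : En (n + 1) →L[ℝ] ℝ) + (x i - y i) • (2 * s) •
          (((s - 1) * Q) • (2 • innerSL ℝ (x - y)))) +
        (2 * s * ρ ^ (s - 1) * (x i - y i)) • (-(2 • innerSL ℝ x)) +
      (ρ ^ s • (-2 : ℝ) • (EuclideanSpace.proj i : En (n + 1) →L[ℝ] ℝ) +
        (-2 * x i) • ((s * ρ ^ (s - 1)) • (2 • innerSL ℝ (x - y)))))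
          (EuclideanSpace.single i 1) := by
      intro i
      simp [EuclideanSpace.inner_single_right]
      ring
    rw [Finset.sum_congr rfl fun i _ => (hterm i).symm]
    rw [Finset.sum_add_distrib, Finset.sum_add_distrib, ← Finset.mul_sum, ← Finset.mul_sum, hzz,
      hxz]
    simp only [Finset.sum_const, Finset.card_univ, Fintype.card_fin, nsmul_eq_mul, e2, e1]
    have hX : X = (ρ - N) / 2 := by linarith
    rw [hX, hs]
    push_cast
    ring
  · filter_upwards [isOpen_ne.mem_nhds hxy] with z hz
    exact (hN z).mul (hpow z s hz)
  · intro i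
    have h1 := (hN x).mul ((((hpow x (s - 1) hxy).const_mul (2 * s))).mul
      ((hcoord i).sub_const (y i)))
    have h2 := (hpow x s hxy).mul ((hcoord i).const_mul (-2))
    refine ((h1.add h2).congr_of_eventuallyEq (Eventually.of_forall fun z => ?_))
    simp [EuclideanSpace.inner_single_right, -mul_eq_mul_left_iff]
    ring

theorem poissonKernel_nonneg {x y : En (n + 1)} (hx : ‖x‖ ≤ 1) : 0 ≤ poissonKernel (x, y) := by
  have : ‖x‖ ^ 2 ≤ 1 := pow_le_one₀ (norm_nonneg x) hx
  exact mul_nonneg (by simpa using this) (by positivity)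

theorem poissonKernel_map (R : En (n + 1) ≃ₗᵢ[ℝ] En (n + 1)) (x y : En (n + 1)) :
    poissonKernel (R x, R y) = poissonKernel (x, y) := by
  simp [poissonKernel, ← map_sub]

/-- A rotation invariant probability measure carried by the unit sphere. -/
def sphereMeasure (n : ℕ) : MeasureTheory.Measure (En (n + 1)) :=
  (exists_invariant_probability_sphere n).choose

instance : MeasureTheory.IsProbabilityMeasure (sphereMeasure n) :=
  (exists_invariant_probability_sphere n).choose_spec.1

theorem ae_mem_sphere : ∀ᵐ x ∂(sphereMeasure n), x ∈ sphere (0 : En (n + 1)) 1 :=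
  (exists_invariant_probability_sphere n).choose_spec.2.1

theorem measurePreserving_sphereMeasure (R : En (n + 1) ≃ₗᵢ[ℝ] En (n + 1)) :
    MeasureTheory.MeasurePreserving R (sphereMeasure n) (sphereMeasure n) :=
  (exists_invariant_probability_sphere n).choose_spec.2.2 R

theorem restrict_sphereMeasure :
    (sphereMeasure n).restrict (sphere 0 1) = sphereMeasure n :=
  MeasureTheory.Measure.restrict_eq_self_of_ae_mem ae_mem_sphere

/-- Unnormalised Poisson integral of `h` over the unit sphere. -/
def poissonInt (h : En (n + 1) → ℝ) (x : En (n + 1)) : ℝ :=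
  ∫ y in sphere (0 : En (n + 1)) 1, h y • poissonKernel (x, y) ∂(sphereMeasure n)

theorem fst_ne_snd_of_mem {x y : En (n + 1)} (hx : x ∈ ball (0 : En (n + 1)) 1)
    (hy : y ∈ sphere (0 : En (n + 1)) 1) : x ≠ y := by
  rintro rfl
  simp only [mem_ball, mem_sphere] at hx hy
  linarith

theorem ball_prod_sphere_subset : ball (0 : En (n + 1)) 1 ×ˢ sphere (0 : En (n + 1)) 1 ⊆
    {p : En (n + 1) × En (n + 1) | p.1 ≠ p.2} := fun _ hp => fst_ne_snd_of_mem hp.1 hp.2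

theorem contDiffOn_poissonInt {h : En (n + 1) → ℝ}
    (hh : ContinuousOn h (sphere (0 : En (n + 1)) 1)) :
    ContDiffOn ℝ (⊤ : ℕ∞) (poissonInt h) (ball 0 1) :=
  contDiffOn_integral_smul (isOpen_offDiag n) (isCompact_sphere 0 1) isOpen_ball
    ball_prod_sphere_subset hh _ contDiffOn_poissonKernel

theorem hasFDerivAt_integral_sphere {F : Type} [NormedAddCommGroup F] [NormedSpace ℝ F]
    {h : En (n + 1) → ℝ} (hh : ContinuousOn h (sphere (0 : En (n + 1)) 1))
    {H : En (n + 1) × En (n + 1) → F} (hH : ContDiffOn ℝ (⊤ : ℕ∞) H {p | p.1 ≠ p.2})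
    {x : En (n + 1)} (hx : x ∈ ball (0 : En (n + 1)) 1) :
    HasFDerivAt (fun x => ∫ y in sphere (0 : En (n + 1)) 1, h y • H (x, y) ∂(sphereMeasure n))
      (∫ y in sphere (0 : En (n + 1)) 1, h y • partialFst H (x, y) ∂(sphereMeasure n)) x :=
  hasFDerivAt_integral_smul_of_contDiffOn (isOpen_offDiag n) (hH.of_le (by simp))
    (isCompact_sphere 0 1) (fun _ hy => fst_ne_snd_of_mem hx hy) hh _

theorem integrableOn_sphere {F : Type} [NormedAddCommGroup F] [NormedSpace ℝ F]
    {h : En (n + 1) → ℝ} (hh : ContinuousOn h (sphere (0 : En (n + 1)) 1))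
    {H : En (n + 1) × En (n + 1) → F} (hH : ContDiffOn ℝ (⊤ : ℕ∞) H {p | p.1 ≠ p.2})
    {x : En (n + 1)} (hx : x ∈ ball (0 : En (n + 1)) 1) :
    MeasureTheory.IntegrableOn (fun y => h y • H (x, y)) (sphere (0 : En (n + 1)) 1)
      (sphereMeasure n) :=
  (hh.smul (hH.continuousOn.comp (f := fun y => (x, y)) (by fun_prop)
    fun _ hy => fst_ne_snd_of_mem hx hy)).integrableOn_compact (isCompact_sphere 0 1)

theorem lap_poissonInt {h : En (n + 1) → ℝ}
    (hh : ContinuousOn h (sphere (0 : En (n + 1)) 1)) {x : En (n + 1)}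
    (hx : x ∈ ball (0 : En (n + 1)) 1) : lap (poissonInt h) x = 0 := by
  have hP := contDiffOn_poissonKernel (n := n)
  have hP1 := contDiffOn_partialFst (isOpen_offDiag n) hP
  have hPi : ∀ e : En (n + 1), ContDiffOn ℝ (⊤ : ℕ∞)
      (fun p => partialFst (poissonKernel (n := n)) p e) {p | p.1 ≠ p.2} := fun e =>
    hP1.clm_apply contDiffOn_const
  have hPii := fun e => contDiffOn_partialFst (isOpen_offDiag n) (hPi e)
  rw [lap_eq_sum_of_hasFDerivAt
    (f' := fun z => ∫ y in sphere (0 : En (n + 1)) 1,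
      h y • partialFst poissonKernel (z, y) ∂(sphereMeasure n))
    (f'' := fun i => ∫ y in sphere (0 : En (n + 1)) 1,
      h y • partialFst (fun p => partialFst poissonKernel p (EuclideanSpace.single i 1)) (x, y)
        ∂(sphereMeasure n)) (x := x) ?_ ?_]
  · have hi : ∀ i : Fin (n + 1), (∫ y in sphere (0 : En (n + 1)) 1,
        h y • partialFst (fun p => partialFst poissonKernel p (EuclideanSpace.single i 1)) (x, y)
        ∂(sphereMeasure n)) (EuclideanSpace.single i 1) = ∫ y in sphere (0 : En (n + 1)) 1,
        (h y • partialFst (fun p => partialFst poissonKernel p (EuclideanSpace.single i 1)) (x, y))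
          (EuclideanSpace.single i 1) ∂(sphereMeasure n) := fun i =>
      ContinuousLinearMap.integral_apply (integrableOn_sphere hh (hPii _) hx) _
    rw [Finset.sum_congr rfl fun i _ => hi i, ← MeasureTheory.integral_finsetSum]
    · refine MeasureTheory.setIntegral_eq_zero_of_forall_eq_zero fun y hy => ?_
      have hl := lap_poissonKernel (x := x) (by simpa using hy) (fst_ne_snd_of_mem hx hy)
      rw [lap_eq_sum_of_hasFDerivAt (f' := fun z => partialFst poissonKernel (z, y))
        (f'' := fun i => partialFst
          (fun p => partialFst poissonKernel p (EuclideanSpace.single i 1)) (x, y))] at hl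
      · simp [← Finset.mul_sum, hl]
      · filter_upwards [isOpen_ne.mem_nhds (fst_ne_snd_of_mem hx hy)] with z hz
        exact hasFDerivAt_partialFst (isOpen_offDiag n) hP hz
      · exact fun i => hasFDerivAt_partialFst (isOpen_offDiag n) (hPi _)
          (fst_ne_snd_of_mem hx hy)
    · intro i _
      exact ((integrableOn_sphere hh (hPii _) hx).apply_continuousLinearMap _)
  · filter_upwards [isOpen_ball.mem_nhds hx] with z hz
    exact hasFDerivAt_integral_sphere hh hP hz
  · intro i
    refine (hasFDerivAt_integral_sphere hh (hPi (EuclideanSpace.single i 1))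
      hx).congr_of_eventuallyEq ?_
    filter_upwards [isOpen_ball.mem_nhds hx] with z hz
    rw [ContinuousLinearMap.integral_apply (integrableOn_sphere hh hP1 hz)]
    rfl

theorem exists_taylor_bound_poissonInt (n : ℕ) : ∃ K : ℝ, 0 ≤ K ∧ ∀ h : En (n + 1) → ℝ,
    ContinuousOn h (sphere (0 : En (n + 1)) 1) → ∀ M : ℝ,
    (∀ y ∈ sphere (0 : En (n + 1)) 1, |h y| ≤ M) →
    ∀ x ∈ closedBall (0 : En (n + 1)) (3 / 4), ∀ z ∈ closedBall (0 : En (n + 1)) (3 / 4),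
      |poissonInt h z - poissonInt h x - fderiv ℝ (poissonInt h) x (z - x)| ≤
        K * M * ‖z - x‖ ^ 2 := by
  have hP := contDiffOn_poissonKernel (n := n)
  have hP1 := contDiffOn_partialFst (isOpen_offDiag n) hP
  have hP2 := contDiffOn_partialFst (isOpen_offDiag n) hP1
  have hcb : closedBall (0 : En (n + 1)) (3 / 4) ⊆ ball 0 1 := closedBall_subset_ball (by norm_num)
  obtain ⟨K, hK⟩ := ((isCompact_closedBall (0 : En (n + 1)) (3 / 4)).prod
    (isCompact_sphere (0 : En (n + 1)) 1)).exists_bound_of_continuousOn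
    (hP2.continuousOn.mono ((prod_mono hcb Subset.rfl).trans ball_prod_sphere_subset))
  refine ⟨max K 0, le_max_right _ _, fun h hh M hM x hx z hz => ?_⟩
  have hder : ∀ u ∈ closedBall (0 : En (n + 1)) (3 / 4), HasFDerivAt (poissonInt h)
      (∫ y in sphere (0 : En (n + 1)) 1, h y • partialFst poissonKernel (u, y)
        ∂(sphereMeasure n)) u := fun u hu => hasFDerivAt_integral_sphere hh hP (hcb hu)
  have hconv := convex_closedBall (0 : En (n + 1)) (3 / 4)
  have hM0 : 0 ≤ M := by
    obtain ⟨y, hy⟩ := (NormedSpace.sphere_nonempty (x := (0 : En (n + 1))) (r := 1)).2 zero_le_one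
    exact (abs_nonneg _).trans (hM y hy)
  have hlip : ∀ u ∈ closedBall (0 : En (n + 1)) (3 / 4),
      ‖(∫ y in sphere (0 : En (n + 1)) 1, h y • partialFst poissonKernel (u, y)
        ∂(sphereMeasure n)) - (∫ y in sphere (0 : En (n + 1)) 1,
          h y • partialFst poissonKernel (x, y) ∂(sphereMeasure n))‖ ≤
        max K 0 * M * ‖u - x‖ := by
    intro u hu
    refine hconv.norm_image_sub_le_of_norm_hasFDerivWithin_le
      (f := fun u => ∫ y in sphere (0 : En (n + 1)) 1, h y • partialFst poissonKernel (u, y)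
        ∂(sphereMeasure n))
      (fun v hv => (hasFDerivAt_integral_sphere hh hP1 (hcb hv)).hasFDerivWithinAt)
      (fun v hv => ?_) hx hu
    rw [restrict_sphereMeasure]
    refine (MeasureTheory.norm_integral_le_of_norm_le_const (C := max K 0 * M) ?_).trans
      (by simp)
    filter_upwards [ae_mem_sphere] with y hy
    rw [norm_smul, mul_comm]
    exact mul_le_mul ((hK (v, y) ⟨hv, hy⟩).trans (le_max_left _ _)) (hM y hy) (norm_nonneg _)
      (le_max_right _ _)
  have hseg : segment ℝ x z ⊆ closedBall (0 : En (n + 1)) (3 / 4) := hconv.segment_subset hx hz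
  have := (convex_segment x z).norm_image_sub_le_of_norm_hasFDerivWithin_le'
    (f := poissonInt h) (C := max K 0 * M * ‖z - x‖)
    (fun v hv => (hder v (hseg hv)).hasFDerivWithinAt)
    (fun v hv => (hlip v (hseg hv)).trans ?_) (left_mem_segment ℝ x z) (right_mem_segment ℝ x z)
  · rw [(hder x hx).fderiv]
    rw [Real.norm_eq_abs] at this
    linarith
  · gcongr
    have := segment_subset_closedBall_left x z hv
    rwa [mem_closedBall, dist_eq_norm, dist_comm, dist_eq_norm] at this

theorem poissonInt_map (h : En (n + 1) → ℝ) (R : En (n + 1) ≃ₗᵢ[ℝ] En (n + 1)) (x : En (n + 1)) :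
    poissonInt h (R x) = poissonInt (h ∘ R) x := by
  simp only [poissonInt, restrict_sphereMeasure]
  rw [← (measurePreserving_sphereMeasure R).integral_comp'
    (f := R.toHomeomorph.toMeasurableEquiv)]
  simp [poissonKernel_map]

theorem poissonInt_one_zero : poissonInt (n := n) (fun _ => 1) 0 = 1 := by
  rw [poissonInt, MeasureTheory.setIntegral_congr_fun (g := fun _ => 1)
    isClosed_sphere.measurableSet, restrict_sphereMeasure]
  · simp
  · intro y hy
    have : ‖y‖ = 1 := by simpa using hy
    simp [poissonKernel, this]

theorem hasDerivAt_line {f : En (n + 1) → ℝ} {x : En (n + 1)} (hf : DifferentiableAt ℝ f x)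
    (e : En (n + 1)) : HasDerivAt (fun t : ℝ => f (x + t • e)) (fderiv ℝ f x e) 0 :=
  hf.hasFDerivAt.hasLineDerivAt e

theorem nonpos_of_harmonic {R : ℝ} {w : En (n + 1) → ℝ}
    (hw : ContinuousOn w (closedBall 0 R)) (hb : ∀ x ∈ sphere (0 : En (n + 1)) R, w x ≤ 0)
    (hc : ∀ x ∈ ball (0 : En (n + 1)) R, ContDiffAt ℝ 2 w x)
    (hlap : ∀ x ∈ ball (0 : En (n + 1)) R, lap w x = 0) :
    ∀ x ∈ closedBall (0 : En (n + 1)) R, w x ≤ 0 := by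
  refine nonpos_of_transmission (α := 1) (β := 1) one_pos hw hb
    (fun x hx _ => ⟨hc x hx, hlap x hx⟩) fun x hx _ => ?_
  have := hasDerivAt_line ((hc x hx).differentiableAt (by simp)) (eN n)
  exact ⟨_, _, this.hasDerivWithinAt, this.hasDerivWithinAt, sub_self _⟩

theorem lap_const (c : ℝ) (x : En n) : lap (fun _ => c) x = 0 := by simp [lap]

theorem poissonInt_one {x : En (n + 1)} (hx : x ∈ ball (0 : En (n + 1)) 1) :
    poissonInt (fun _ => 1) x = 1 := by
  set u : En (n + 1) → ℝ := poissonInt (fun _ => 1) with hu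
  have h1 : ContinuousOn (fun _ : En (n + 1) => (1 : ℝ)) (sphere (0 : En (n + 1)) 1) :=
    continuousOn_const
  have hxn : ‖x‖ < 1 := by simpa using hx
  have hcd := contDiffOn_poissonInt h1
  have hsub : closedBall (0 : En (n + 1)) ‖x‖ ⊆ ball 0 1 := closedBall_subset_ball hxn
  have hsphere : ∀ z ∈ sphere (0 : En (n + 1)) ‖x‖, u z = u x := by
    intro z hz
    have hz' : ‖x‖ = ‖z‖ := by simpa [eq_comm] using hz
    rw [hu, ← Submodule.reflection_sub hz', poissonInt_map]
    rfl
  have hat : ∀ z ∈ ball (0 : En (n + 1)) ‖x‖, ContDiffAt ℝ 2 u z := fun z hz =>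
    (hcd.contDiffAt (isOpen_ball.mem_nhds (hsub (ball_subset_closedBall hz)))).of_le
      (WithTop.coe_le_coe.2 le_top)
  have hl : ∀ z ∈ ball (0 : En (n + 1)) ‖x‖, lap u z = 0 := fun z hz =>
    lap_poissonInt h1 (hsub (ball_subset_closedBall hz))
  have hcont := hcd.continuousOn.mono hsub
  have h0 : (0 : En (n + 1)) ∈ closedBall (0 : En (n + 1)) ‖x‖ := by simp
  have hle := nonpos_of_harmonic (R := ‖x‖) (w := fun z => u z + (-u x) * 1)
    (hcont.add continuousOn_const) (fun z hz => by simp [hsphere z hz])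
    (fun z hz => (hat z hz).add contDiffAt_const)
    (fun z hz => by
      rw [lap_add_const_mul (hat z hz) contDiffAt_const, hl z hz, lap_const]; simp) 0 h0
  have hge := nonpos_of_harmonic (R := ‖x‖) (w := fun z => u x + (-1) * u z)
    (continuousOn_const.add (continuousOn_const.mul hcont)) (fun z hz => by simp [hsphere z hz])
    (fun z hz => contDiffAt_const.add (contDiffAt_const.mul (hat z hz)))
    (fun z hz => by
      rw [lap_add_const_mul contDiffAt_const (hat z hz), hl z hz, lap_const]; simp) 0 h0
  have h01 : u 0 = 1 := poissonInt_one_zero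
  simp only [h01] at hle hge
  linarith

theorem abs_poissonInt_sub_le {h : En (n + 1) → ℝ}
    (hh : ContinuousOn h (sphere (0 : En (n + 1)) 1)) {x : En (n + 1)}
    (hx : x ∈ ball (0 : En (n + 1)) 1) {c A B : ℝ}
    (hb : ∀ y ∈ sphere (0 : En (n + 1)) 1,
      |h y - c| * poissonKernel (x, y) ≤ A * poissonKernel (x, y) + B) :
    |poissonInt h x - c| ≤ A + B := by
  have hi := integrableOn_sphere hh contDiffOn_poissonKernel hx
  have hP : MeasureTheory.IntegrableOn (fun y => (1 : ℝ) • poissonKernel (x, y))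
    (sphere (0 : En (n + 1)) 1) (sphereMeasure n) := integrableOn_sphere (h := fun _ => 1)
      continuousOn_const contDiffOn_poissonKernel hx
  have h1 : (∫ y in sphere (0 : En (n + 1)) 1, (1 : ℝ) • poissonKernel (x, y)
      ∂(sphereMeasure n)) = 1 := poissonInt_one hx
  have e1 : poissonInt h x - c = ∫ y in sphere (0 : En (n + 1)) 1,
      (h y - c) * poissonKernel (x, y) ∂(sphereMeasure n) := by
    calc poissonInt h x - c = poissonInt h x - c * ∫ y in sphere (0 : En (n + 1)) 1,
          (1 : ℝ) • poissonKernel (x, y) ∂(sphereMeasure n) := by rw [h1, mul_one]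
      _ = _ := by
        rw [poissonInt, ← MeasureTheory.integral_const_mul,
          ← MeasureTheory.integral_sub hi (hP.const_mul c)]
        congr 1
        ext y
        simp only [smul_eq_mul]
        ring
  have e2 : A + B = ∫ y in sphere (0 : En (n + 1)) 1,
      (A * ((1 : ℝ) • poissonKernel (x, y)) + B) ∂(sphereMeasure n) := by
    rw [MeasureTheory.integral_add (hP.const_mul A) (MeasureTheory.integrable_const B),
      MeasureTheory.integral_const_mul, h1, restrict_sphereMeasure]
    simp
  rw [e1, e2, ← Real.norm_eq_abs]
  refine MeasureTheory.norm_integral_le_of_norm_le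
    ((hP.const_mul A).add (MeasureTheory.integrable_const B)) ?_
  filter_upwards [MeasureTheory.ae_restrict_mem isClosed_sphere.measurableSet] with y hy
  have hx1 : ‖x‖ ≤ 1 := by simpa using (mem_ball.1 hx).le
  rw [norm_mul, Real.norm_eq_abs, Real.norm_of_nonneg (poissonKernel_nonneg hx1)]
  simpa using hb y hy

theorem poissonKernel_le {x y : En (n + 1)} {δ : ℝ} (hδ : 0 < δ) (hx : ‖x‖ ≤ 1)
    (h : δ ≤ dist x y) :
    poissonKernel (x, y) ≤ (1 - ‖x‖ ^ 2) * (δ ^ 2) ^ (-((n : ℝ) + 1) / 2) := by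
  have : ‖x‖ ^ 2 ≤ 1 := pow_le_one₀ (norm_nonneg x) hx
  refine mul_le_mul_of_nonneg_left ?_ (by linarith)
  refine Real.rpow_le_rpow_of_nonpos (by positivity) ?_ ?_
  · rw [← dist_eq_norm]
    gcongr
  · have : (0 : ℝ) ≤ n := n.cast_nonneg
    linarith

/-- The harmonic function on the unit ball with boundary values `h`. -/
def dirichletExt (h : En (n + 1) → ℝ) (x : En (n + 1)) : ℝ :=
  if x ∈ ball (0 : En (n + 1)) 1 then poissonInt h x else h x

theorem dirichletExt_of_mem_ball (h : En (n + 1) → ℝ) {x : En (n + 1)}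
    (hx : x ∈ ball (0 : En (n + 1)) 1) : dirichletExt h x = poissonInt h x := if_pos hx

theorem dirichletExt_of_mem_sphere (h : En (n + 1) → ℝ) {x : En (n + 1)}
    (hx : x ∈ sphere (0 : En (n + 1)) 1) : dirichletExt h x = h x :=
  if_neg fun hb => fst_ne_snd_of_mem hb hx rfl

theorem dirichletExt_eventuallyEq (h : En (n + 1) → ℝ) {x : En (n + 1)}
    (hx : x ∈ ball (0 : En (n + 1)) 1) : dirichletExt h =ᶠ[𝓝 x] poissonInt h := by
  filter_upwards [isOpen_ball.mem_nhds hx] with y hy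
  exact dirichletExt_of_mem_ball h hy

theorem continuousOn_dirichletExt {h : En (n + 1) → ℝ}
    (hh : ContinuousOn h (sphere (0 : En (n + 1)) 1)) :
    ContinuousOn (dirichletExt h) (closedBall 0 1) := by
  intro ζ hζ
  by_cases hb : ζ ∈ ball (0 : En (n + 1)) 1
  · refine ContinuousAt.continuousWithinAt ?_
    refine ((contDiffOn_poissonInt hh).continuousOn.continuousAt
      (isOpen_ball.mem_nhds hb)).congr ?_
    exact (dirichletExt_eventuallyEq h hb).symm
  have hζs : ζ ∈ sphere (0 : En (n + 1)) 1 := by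
    simp only [mem_sphere, mem_ball, mem_closedBall, not_lt] at *
    exact le_antisymm hζ hb
  obtain ⟨M, hM⟩ := (isCompact_sphere (0 : En (n + 1)) 1).exists_bound_of_continuousOn hh
  rw [Metric.continuousWithinAt_iff']
  intro ε hε
  obtain ⟨δ, hδ, hδε⟩ := Metric.continuousWithinAt_iff.1 (hh ζ hζs) (ε / 2) (half_pos hε)
  set Q : ℝ := ((δ / 2) ^ 2) ^ (-((n : ℝ) + 1) / 2)
  have hM0 : 0 ≤ M := (norm_nonneg _).trans (hM ζ hζs)
  have hlim : Tendsto (fun x : En (n + 1) => 2 * M * ((1 - ‖x‖ ^ 2) * Q)) (𝓝 ζ) (𝓝 0) := by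
    have hc : Continuous fun x : En (n + 1) => 2 * M * ((1 - ‖x‖ ^ 2) * Q) := by fun_prop
    have hζ1 : ‖ζ‖ = 1 := by simpa using hζs
    simpa [hζ1] using hc.tendsto ζ
  filter_upwards [self_mem_nhdsWithin, nhdsWithin_le_nhds (ball_mem_nhds ζ (half_pos hδ)),
    (hlim.eventually_lt_const (half_pos hε)).filter_mono nhdsWithin_le_nhds] with x hx hxδ hxQ
  rw [dirichletExt_of_mem_sphere h hζs]
  have hx1 : ‖x‖ ≤ 1 := by simpa using hx
  by_cases hxb : x ∈ ball (0 : En (n + 1)) 1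
  · rw [dirichletExt_of_mem_ball h hxb, Real.dist_eq]
    refine (abs_poissonInt_sub_le hh hxb (A := ε / 2) (B := 2 * M * ((1 - ‖x‖ ^ 2) * Q))
      fun y hy => ?_).trans_lt (by linarith)
    have hP0 := poissonKernel_nonneg (y := y) hx1
    have hx2 : ‖x‖ ^ 2 ≤ 1 := pow_le_one₀ (norm_nonneg x) hx1
    have hB0 : 0 ≤ 2 * M * ((1 - ‖x‖ ^ 2) * Q) :=
      mul_nonneg (by positivity) (mul_nonneg (by linarith) (by positivity))
    by_cases hyδ : dist y ζ < δ
    · have := hδε hy hyδ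
      rw [Real.dist_eq] at this
      have := mul_le_mul_of_nonneg_right this.le hP0
      linarith
    · have hxy : δ / 2 ≤ dist x y := by
        have h1 := dist_triangle_left y ζ x
        have h2 : dist x ζ < δ / 2 := hxδ
        linarith
      have h1 : |h y - h ζ| ≤ 2 * M := by
        have := norm_sub_le_of_le (hM y hy) (hM ζ hζs)
        rw [Real.norm_eq_abs] at this
        linarith
      have h2 := mul_le_mul h1 (poissonKernel_le (half_pos hδ) hx1 hxy) hP0 (by positivity)
      have h3 : 0 ≤ ε / 2 * poissonKernel (x, y) := by positivity
      linarith
  · have hxs : x ∈ sphere (0 : En (n + 1)) 1 := by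
      simp only [mem_sphere, mem_ball, mem_closedBall, not_lt] at *
      exact le_antisymm hx hxb
    rw [dirichletExt_of_mem_sphere h hxs]
    have h2 : dist x ζ < δ / 2 := hxδ
    have := hδε hxs (h2.trans (by linarith))
    linarith

theorem poissonInt_linear {f g : En (n + 1) → ℝ}
    (hf : ContinuousOn f (sphere (0 : En (n + 1)) 1))
    (hg : ContinuousOn g (sphere (0 : En (n + 1)) 1)) (a b : ℝ) {x : En (n + 1)}
    (hx : x ∈ ball (0 : En (n + 1)) 1) :
    poissonInt (fun y => a * f y + b * g y) x = a * poissonInt f x + b * poissonInt g x := by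
  have hif := integrableOn_sphere hf contDiffOn_poissonKernel hx
  have hig := integrableOn_sphere hg contDiffOn_poissonKernel hx
  simp only [poissonInt]
  rw [← MeasureTheory.integral_const_mul, ← MeasureTheory.integral_const_mul,
    ← MeasureTheory.integral_add (hif.const_mul a) (hig.const_mul b)]
  congr 1
  ext y
  simp only [smul_eq_mul]
  ring

/-- The reflection across `{xₙ = 0}`. -/
def reflN (n : ℕ) : En (n + 1) ≃ₗᵢ[ℝ] En (n + 1) := (ℝ ∙ eN n)ᗮ.reflection

theorem reflN_apply (x : En (n + 1)) : reflN n x = x - (2 * xN x) • eN n := by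
  have h1 : ⟪eN n, x⟫ = xN x := by simp [eN, xN, EuclideanSpace.inner_single_left]
  have h2 : ‖eN n‖ = 1 := by simp [eN]
  rw [reflN, Submodule.reflection_orthogonal_apply, Submodule.reflection_singleton_apply, h1, h2]
  simp only [RCLike.ofReal_real_eq_id, id, one_pow, div_one]
  module

theorem reflN_eq_self {x : En (n + 1)} (hx : xN x = 0) : reflN n x = x := by
  simp [reflN_apply, hx]

theorem xN_reflN (x : En (n + 1)) : xN (reflN n x) = -xN x := by
  rw [reflN_apply, sub_eq_add_neg, ← neg_smul, xN_add_smul_eN]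
  ring

theorem reflN_reflN (x : En (n + 1)) : reflN n (reflN n x) = x :=
  Submodule.reflection_reflection _ x

theorem reflN_add_smul_eN {x : En (n + 1)} (hx : xN x = 0) (t : ℝ) :
    reflN n (x + t • eN n) = x + (-t) • eN n := by
  rw [reflN_apply, xN_add_smul_eN, hx]
  module

/-- The fold of the space onto `{xₙ ≥ 0}`. -/
def foldUp (x : En (n + 1)) : En (n + 1) := x + (|xN x| - xN x) • eN n

/-- The fold of the space onto `{xₙ ≤ 0}`. -/
def foldDown (x : En (n + 1)) : En (n + 1) := x - (|xN x| + xN x) • eN n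

theorem fold_of_nonneg {x : En (n + 1)} (hx : 0 ≤ xN x) :
    foldUp x = x ∧ foldDown x = reflN n x := by
  simp [foldUp, foldDown, reflN_apply, abs_of_nonneg hx, two_mul]

theorem fold_of_nonpos {x : En (n + 1)} (hx : xN x ≤ 0) :
    foldUp x = reflN n x ∧ foldDown x = x := by
  simp only [foldUp, foldDown, reflN_apply, abs_of_nonpos hx]
  constructor <;> module

theorem fold_reflN (x : En (n + 1)) :
    foldUp (reflN n x) = foldUp x ∧ foldDown (reflN n x) = foldDown x := by
  simp only [foldUp, foldDown, xN_reflN, abs_neg]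
  simp only [reflN_apply]
  constructor <;> module

theorem reflN_mem_sphere {x : En (n + 1)} (hx : x ∈ sphere (0 : En (n + 1)) 1) :
    reflN n x ∈ sphere (0 : En (n + 1)) 1 := by
  simpa using hx

theorem fold_mem_sphere {x : En (n + 1)} (hx : x ∈ sphere (0 : En (n + 1)) 1) :
    foldUp x ∈ sphere (0 : En (n + 1)) 1 ∧ foldDown x ∈ sphere (0 : En (n + 1)) 1 := by
  rcases le_total 0 (xN x) with h | h
  · rw [(fold_of_nonneg h).1, (fold_of_nonneg h).2]
    exact ⟨hx, reflN_mem_sphere hx⟩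
  · rw [(fold_of_nonpos h).1, (fold_of_nonpos h).2]
    exact ⟨reflN_mem_sphere hx, hx⟩

/-- The even data for the Neumann part of the transmission problem. -/
def evenData (α β : ℝ) (h : En (n + 1) → ℝ) (y : En (n + 1)) : ℝ :=
  α ^ 2 * h (foldUp y) + β ^ 2 * h (foldDown y)

/-- The odd data for the Dirichlet part of the transmission problem. -/
def oddData (h : En (n + 1) → ℝ) (y : En (n + 1)) : ℝ := h y - h (reflN n y)

/-- The boundary data whose harmonic extension solves the transmission problem on one side. -/
def transData (α β c : ℝ) (h : En (n + 1) → ℝ) (y : En (n + 1)) : ℝ :=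
  (α ^ 2 + β ^ 2)⁻¹ * evenData α β h y + ((α ^ 2 + β ^ 2)⁻¹ * c) * oddData h y

/-- The solution of the transmission problem with boundary data `h`. -/
def transSol (α β : ℝ) (h : En (n + 1) → ℝ) (x : En (n + 1)) : ℝ :=
  if 0 ≤ xN x then dirichletExt (transData α β (β ^ 2) h) x
  else dirichletExt (transData α β (α ^ 2) h) x

section Data

variable {α β : ℝ} {h : En (n + 1) → ℝ}

theorem evenData_reflN (y : En (n + 1)) : evenData α β h (reflN n y) = evenData α β h y := by
  simp only [evenData, fold_reflN]

theorem oddData_reflN (y : En (n + 1)) : oddData h (reflN n y) = -oddData h y := by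
  simp only [oddData, reflN_reflN, neg_sub]

theorem oddData_eq_zero {y : En (n + 1)} (hy : xN y = 0) : oddData h y = 0 := by
  simp [oddData, reflN_eq_self hy]

theorem continuousOn_evenData (hh : ContinuousOn h (sphere (0 : En (n + 1)) 1)) :
    ContinuousOn (evenData α β h) (sphere (0 : En (n + 1)) 1) := by
  have hc := continuous_xN (n := n)
  have h1 : Continuous (foldUp : En (n + 1) → En (n + 1)) := by unfold foldUp; fun_prop
  have h2 : Continuous (foldDown : En (n + 1) → En (n + 1)) := by unfold foldDown; fun_prop
  exact (continuousOn_const.mul (hh.comp h1.continuousOn fun y hy => (fold_mem_sphere hy).1)).add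
    (continuousOn_const.mul (hh.comp h2.continuousOn fun y hy => (fold_mem_sphere hy).2))

theorem continuousOn_oddData (hh : ContinuousOn h (sphere (0 : En (n + 1)) 1)) :
    ContinuousOn (oddData h) (sphere (0 : En (n + 1)) 1) :=
  hh.sub (hh.comp (reflN n).continuous.continuousOn fun _ hy => reflN_mem_sphere hy)

theorem continuousOn_transData (hh : ContinuousOn h (sphere (0 : En (n + 1)) 1))
    (c : ℝ) :
    ContinuousOn (transData α β c h) (sphere (0 : En (n + 1)) 1) :=
  (continuousOn_const.mul (continuousOn_evenData hh)).add
    (continuousOn_const.mul (continuousOn_oddData hh))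

theorem poissonInt_transData (hh : ContinuousOn h (sphere (0 : En (n + 1)) 1))
    (c : ℝ) {x : En (n + 1)} (hx : x ∈ ball (0 : En (n + 1)) 1) :
    poissonInt (transData α β c h) x = (α ^ 2 + β ^ 2)⁻¹ * poissonInt (evenData α β h) x +
      ((α ^ 2 + β ^ 2)⁻¹ * c) * poissonInt (oddData h) x :=
  poissonInt_linear (continuousOn_evenData hh) (continuousOn_oddData hh) _ _ hx

theorem differentiableAt_poissonInt (hh : ContinuousOn h (sphere (0 : En (n + 1)) 1))
    {x : En (n + 1)} (hx : x ∈ ball (0 : En (n + 1)) 1) :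
    DifferentiableAt ℝ (poissonInt h) x :=
  ((contDiffOn_poissonInt hh).contDiffAt (isOpen_ball.mem_nhds hx)).differentiableAt (by simp)

theorem fderiv_poissonInt_transData (hh : ContinuousOn h (sphere (0 : En (n + 1)) 1))
    (c : ℝ) {x : En (n + 1)}
    (hx : x ∈ ball (0 : En (n + 1)) 1) (e : En (n + 1)) :
    fderiv ℝ (poissonInt (transData α β c h)) x e =
      (α ^ 2 + β ^ 2)⁻¹ * fderiv ℝ (poissonInt (evenData α β h)) x e +
      ((α ^ 2 + β ^ 2)⁻¹ * c) * fderiv ℝ (poissonInt (oddData h)) x e := by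
  have hev : poissonInt (transData α β c h) =ᶠ[𝓝 x] fun z =>
      (α ^ 2 + β ^ 2)⁻¹ * poissonInt (evenData α β h) z +
      ((α ^ 2 + β ^ 2)⁻¹ * c) * poissonInt (oddData h) z := by
    filter_upwards [isOpen_ball.mem_nhds hx] with z hz
    exact poissonInt_transData hh c hz
  have h1 := (differentiableAt_poissonInt (continuousOn_evenData (α := α) (β := β) hh)
    hx).hasFDerivAt.const_mul ((α ^ 2 + β ^ 2)⁻¹)
  have h2 := (differentiableAt_poissonInt (continuousOn_oddData hh)
    hx).hasFDerivAt.const_mul ((α ^ 2 + β ^ 2)⁻¹ * c)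
  rw [((h1.add h2).congr_of_eventuallyEq hev).fderiv]
  simp

theorem poissonInt_evenData_reflN (x : En (n + 1)) :
    poissonInt (evenData α β h) (reflN n x) = poissonInt (evenData α β h) x := by
  rw [poissonInt_map]
  congr 1
  ext y
  exact evenData_reflN y

theorem poissonInt_oddData_eq_zero {x : En (n + 1)} (hx : xN x = 0) :
    poissonInt (oddData h) x = 0 := by
  have h1 := poissonInt_map (oddData h) (reflN n) x
  have h2 : oddData h ∘ reflN n = fun y => -oddData h y := by
    ext y
    exact oddData_reflN y
  rw [h2, reflN_eq_self hx] at h1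
  have h3 : poissonInt (fun y => -oddData h y) x = -poissonInt (oddData h) x := by
    simp [poissonInt, MeasureTheory.integral_neg]
  linarith

theorem fderiv_poissonInt_evenData_eN (hh : ContinuousOn h (sphere (0 : En (n + 1)) 1))
    {x : En (n + 1)} (hx : x ∈ ball (0 : En (n + 1)) 1)
    (hxN : xN x = 0) : fderiv ℝ (poissonInt (evenData α β h)) x (eN n) = 0 := by
  have h1 := hasDerivAt_line (differentiableAt_poissonInt (continuousOn_evenData
    (α := α) (β := β) hh) hx) (eN n)
  have h2 : HasDerivAt (fun t : ℝ => poissonInt (evenData α β h) (x + (-t) • eN n))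
      (-fderiv ℝ (poissonInt (evenData α β h)) x (eN n)) 0 := by
    have h0 : HasDerivAt (fun t : ℝ => -t) (-1) 0 := hasDerivAt_neg 0
    have := HasDerivAt.comp (0 : ℝ) (by simpa using h1) h0
    exact this.congr_deriv (by simp)
  have h3 : (fun t : ℝ => poissonInt (evenData α β h) (x + (-t) • eN n)) =
      fun t : ℝ => poissonInt (evenData α β h) (x + t • eN n) := by
    ext t
    rw [← reflN_add_smul_eN hxN, poissonInt_evenData_reflN]
  rw [h3] at h2
  linarith [h1.unique h2]

theorem fderiv_poissonInt_oddData (hh : ContinuousOn h (sphere (0 : En (n + 1)) 1))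
    {x e : En (n + 1)} (hx : x ∈ ball (0 : En (n + 1)) 1)
    (hxN : xN x = 0) (he : xN e = 0) : fderiv ℝ (poissonInt (oddData h)) x e = 0 := by
  have h1 := hasDerivAt_line (differentiableAt_poissonInt (continuousOn_oddData hh) hx) e
  have h3 : (fun t : ℝ => poissonInt (oddData h) (x + t • e)) = fun _ => 0 := by
    ext t
    refine poissonInt_oddData_eq_zero ?_
    have : xN (x + t • e) = xN x + t * xN e := by simp [xN]
    rw [this, hxN, he]; simp
  rw [h3] at h1
  exact h1.unique (hasDerivAt_const _ _)

theorem dirichletExt_transData_eq (hh : ContinuousOn h (sphere (0 : En (n + 1)) 1))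
    {x : En (n + 1)} (hxN : xN x = 0) (c c' : ℝ) :
    dirichletExt (transData α β c h) x = dirichletExt (transData α β c' h) x := by
  by_cases hb : x ∈ ball (0 : En (n + 1)) 1
  · rw [dirichletExt_of_mem_ball _ hb, dirichletExt_of_mem_ball _ hb, poissonInt_transData hh _ hb,
      poissonInt_transData hh _ hb, poissonInt_oddData_eq_zero hxN]
    simp
  · simp [dirichletExt, hb, transData, oddData_eq_zero hxN]

theorem transSol_of_nonneg {x : En (n + 1)} (hxN : 0 ≤ xN x) :
    transSol α β h x = dirichletExt (transData α β (β ^ 2) h) x := if_pos hxN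

theorem transSol_of_nonpos (hh : ContinuousOn h (sphere (0 : En (n + 1)) 1))
    {x : En (n + 1)} (hxN : xN x ≤ 0) :
    transSol α β h x = dirichletExt (transData α β (α ^ 2) h) x := by
  rcases hxN.lt_or_eq with h' | h'
  · exact if_neg h'.not_ge
  · rw [transSol_of_nonneg h'.ge, dirichletExt_transData_eq hh h']

theorem continuousOn_transSol (hh : ContinuousOn h (sphere (0 : En (n + 1)) 1)) :
    ContinuousOn (transSol α β h) (closedBall 0 1) := by
  have hc := continuous_xN (n := n)
  have hp : ContinuousOn (transSol α β h) (closedBall 0 1 ∩ {x | 0 ≤ xN x}) :=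
    ((continuousOn_dirichletExt (continuousOn_transData hh (β ^ 2))).mono
      inter_subset_left).congr fun x hx => transSol_of_nonneg hx.2
  have hm : ContinuousOn (transSol α β h) (closedBall 0 1 ∩ {x | xN x ≤ 0}) :=
    ((continuousOn_dirichletExt (continuousOn_transData hh (α ^ 2))).mono
      inter_subset_left).congr fun x hx => transSol_of_nonpos hh hx.2
  refine (hp.union_of_isClosed hm (isClosed_closedBall.inter (isClosed_le continuous_const hc))
    (isClosed_closedBall.inter (isClosed_le hc continuous_const))).mono fun x hx => ?_
  rcases le_total 0 (xN x) with h' | h'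
  exacts [Or.inl ⟨hx, h'⟩, Or.inr ⟨hx, h'⟩]

theorem contDiffOn_dirichletExt (hh : ContinuousOn h (sphere (0 : En (n + 1)) 1)) :
    ContDiffOn ℝ (⊤ : ℕ∞) (dirichletExt h) (ball 0 1) :=
  (contDiffOn_poissonInt hh).congr fun _ hx => dirichletExt_of_mem_ball h hx

theorem lap_congr {f g : En n → ℝ} {x : En n} (hfg : f =ᶠ[𝓝 x] g) : lap f x = lap g x := by
  refine Finset.sum_congr rfl fun i _ => ?_
  have : (fun y => fderiv ℝ f y (EuclideanSpace.single i 1)) =ᶠ[𝓝 x]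
      fun y => fderiv ℝ g y (EuclideanSpace.single i 1) := by
    filter_upwards [hfg.fderiv (𝕜 := ℝ)] with y hy
    rw [hy]
  rw [this.fderiv_eq]

theorem lap_dirichletExt (hh : ContinuousOn h (sphere (0 : En (n + 1)) 1))
    {x : En (n + 1)} (hx : x ∈ ball (0 : En (n + 1)) 1) :
    lap (dirichletExt h) x = 0 :=
  (lap_congr (dirichletExt_eventuallyEq h hx)).trans (lap_poissonInt hh hx)

theorem hasDerivAt_dirichletExt_line (hh : ContinuousOn h (sphere (0 : En (n + 1)) 1))
    {x : En (n + 1)} (hx : x ∈ ball (0 : En (n + 1)) 1) :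
    HasDerivAt (fun t : ℝ => dirichletExt h (x + t • eN n))
      (fderiv ℝ (poissonInt h) x (eN n)) 0 := by
  rw [← (dirichletExt_eventuallyEq h hx).fderiv_eq]
  exact hasDerivAt_line (((contDiffOn_dirichletExt hh).contDiffAt
    (isOpen_ball.mem_nhds hx)).differentiableAt (by simp)) _

theorem classicalTrans_transSol (hh : ContinuousOn h (sphere (0 : En (n + 1)) 1)) :
    ClassicalTrans α β (ball 0 1) (transSol α β h) := by
  have hc := continuous_xN (n := n)
  have hp := continuousOn_transData (α := α) (β := β) hh (β ^ 2)
  have hm := continuousOn_transData (α := α) (β := β) hh (α ^ 2)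
  refine ⟨?_, ?_, fun x hx hxN => ?_, fun x hx hxN => ?_⟩
  · exact ((contDiffOn_dirichletExt hp).mono inter_subset_left).congr
      fun x hx => transSol_of_nonneg hx.2
  · exact ((contDiffOn_dirichletExt hm).mono inter_subset_left).congr
      fun x hx => transSol_of_nonpos hh hx.2
  · rcases lt_or_gt_of_ne hxN with h' | h'
    · rw [← lap_dirichletExt hm hx]
      refine lap_congr ?_
      filter_upwards [hc.continuousAt.eventually_lt_const h'] with y hyN
      exact transSol_of_nonpos hh hyN.le
    · rw [← lap_dirichletExt hp hx]
      refine lap_congr ?_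
      filter_upwards [hc.continuousAt.eventually_const_lt h'] with y hyN
      exact transSol_of_nonneg hyN.le
  · refine ⟨_, _, (hasDerivAt_dirichletExt_line hp hx).hasDerivWithinAt.congr ?_ ?_,
      (hasDerivAt_dirichletExt_line hm hx).hasDerivWithinAt.congr ?_ ?_, ?_⟩
    · exact fun t ht => transSol_of_nonneg (by rw [xN_add_smul_eN, hxN, zero_add]; exact ht)
    · exact transSol_of_nonneg (by simp [hxN])
    · intro t ht
      rcases (mem_Iic.1 ht).lt_or_eq with h' | rfl
      · exact if_neg (by rw [xN_add_smul_eN, hxN, zero_add]; exact h'.not_ge)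
      · simpa using transSol_of_nonpos hh hxN.le
    · simpa using transSol_of_nonpos hh hxN.le
    · rw [fderiv_poissonInt_transData hh _ hx, fderiv_poissonInt_transData hh _ hx,
        fderiv_poissonInt_evenData_eN hh hx hxN]
      ring

theorem transSol_eqOn_sphere (hα : 0 < α) : EqOn (transSol α β h) h (sphere 0 1) := by
  intro x hx
  have hγ : α ^ 2 + β ^ 2 ≠ 0 := by positivity
  rw [transSol, dirichletExt_of_mem_sphere _ hx, dirichletExt_of_mem_sphere _ hx]
  split_ifs with hxN
  · simp only [transData, evenData, oddData, fold_of_nonneg hxN]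
    field_simp
    ring
  · simp only [transData, evenData, oddData, fold_of_nonpos (not_le.1 hxN).le]
    field_simp
    ring

theorem abs_transData_le (hα : 0 < α) {c M : ℝ} (hc0 : 0 ≤ c) (hc : c ≤ α ^ 2 + β ^ 2)
    (hM : ∀ y ∈ sphere (0 : En (n + 1)) 1, |h y| ≤ M) {y : En (n + 1)}
    (hy : y ∈ sphere (0 : En (n + 1)) 1) : |transData α β c h y| ≤ 3 * M := by
  have hγ : 0 < α ^ 2 + β ^ 2 := by positivity
  have hM0 : 0 ≤ M := (abs_nonneg _).trans (hM y hy)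
  have h1 := hM _ (fold_mem_sphere hy).1
  have h2 := hM _ (fold_mem_sphere hy).2
  have he : |evenData α β h y| ≤ (α ^ 2 + β ^ 2) * M := by
    refine (abs_add_le _ _).trans ?_
    rw [abs_mul, abs_mul, abs_of_nonneg (sq_nonneg α), abs_of_nonneg (sq_nonneg β), add_mul]
    gcongr
  have ho : |oddData h y| ≤ 2 * M := by
    refine (abs_sub _ _).trans ?_
    linarith [hM y hy, hM _ (reflN_mem_sphere hy)]
  calc |transData α β c h y| = (α ^ 2 + β ^ 2)⁻¹ * |evenData α β h y + c * oddData h y| := by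
        have : transData α β c h y =
            (α ^ 2 + β ^ 2)⁻¹ * (evenData α β h y + c * oddData h y) := by rw [transData]; ring
        rw [this, abs_mul, abs_of_pos (inv_pos.2 hγ)]
    _ ≤ (α ^ 2 + β ^ 2)⁻¹ * ((α ^ 2 + β ^ 2) * M + (α ^ 2 + β ^ 2) * (2 * M)) := by
        gcongr
        refine (abs_add_le _ _).trans (add_le_add he ?_)
        rw [abs_mul, abs_of_nonneg hc0]
        gcongr
    _ = 3 * M := by field_simp; ring

end Data

theorem eqOn_of_classicalTrans {α β : ℝ} (hα : 0 < α) {v w : En (n + 1) → ℝ}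
    (hv : ContinuousOn v (closedBall 0 1)) (hw : ContinuousOn w (closedBall 0 1))
    (hvw : EqOn v w (sphere 0 1)) (hvt : ClassicalTrans α β (ball 0 1) v)
    (hwt : ClassicalTrans α β (ball 0 1) w) : EqOn v w (closedBall 0 1) := by
  have hat : ∀ {u : En (n + 1) → ℝ}, ClassicalTrans α β (ball 0 1) u →
      ∀ x ∈ ball (0 : En (n + 1)) 1, xN x ≠ 0 → ContDiffAt ℝ 2 u x := by
    intro u hu x hx hxN
    have hc := continuous_xN (n := n)
    have h2 : (2 : WithTop ℕ∞) ≤ ((⊤ : ℕ∞) : WithTop ℕ∞) := WithTop.coe_le_coe.2 le_top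
    rcases lt_or_gt_of_ne hxN with h | h
    · refine (hu.2.1.contDiffAt (inter_mem (isOpen_ball.mem_nhds hx) ?_)).of_le h2
      filter_upwards [hc.continuousAt.eventually_lt_const h] with y hy using hy.le
    · refine (hu.1.contDiffAt (inter_mem (isOpen_ball.mem_nhds hx) ?_)).of_le h2
      filter_upwards [hc.continuousAt.eventually_const_lt h] with y hy using hy.le
  have key : ∀ {v w : En (n + 1) → ℝ}, ContinuousOn v (closedBall 0 1) →
      ContinuousOn w (closedBall 0 1) → EqOn v w (sphere 0 1) →
      ClassicalTrans α β (ball 0 1) v → ClassicalTrans α β (ball 0 1) w →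
      ∀ x ∈ closedBall (0 : En (n + 1)) 1, v x ≤ w x := by
    intro v w hv hw hvw hvt hwt x hx
    have := nonpos_of_transmission (α := α) (β := β) (R := 1) (w := fun y => v y + (-1) * w y) hα
      (hv.add (continuousOn_const.mul hw)) (fun y hy => by simp [hvw hy])
      (fun y hy hyN => ⟨(hat hvt y hy hyN).add (contDiffAt_const.mul (hat hwt y hy hyN)), by
        rw [lap_add_const_mul (hat hvt y hy hyN) (hat hwt y hy hyN), hvt.2.2.1 y hy hyN,
          hwt.2.2.1 y hy hyN]; simp⟩)
      (fun y hy hyN => by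
        obtain ⟨dp, dm, hp, hm, he⟩ := hvt.2.2.2 y hy hyN
        obtain ⟨dp', dm', hp', hm', he'⟩ := hwt.2.2.2 y hy hyN
        exact ⟨_, _, hp.add (hp'.const_mul (-1)), hm.add (hm'.const_mul (-1)), by linarith⟩) x hx
    linarith
  exact fun x hx => le_antisymm (key hv hw hvw hvt hwt x hx) (key hw hv hvw.symm hwt hvt x hx)

theorem clm_apply_eq_inner_add (L : En (n + 1) →L[ℝ] ℝ) (x : En (n + 1)) :
    L x = ⟪WithLp.toLp 2 (fun i : Fin n => L (EuclideanSpace.single i.castSucc 1)), xT x⟫ +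
      xN x * L (eN n) := by
  have hx : x = ∑ i, x i • EuclideanSpace.single i (1 : ℝ) := by
    simpa using ((EuclideanSpace.basisFun (Fin (n + 1)) ℝ).sum_repr x).symm
  conv_lhs => rw [hx]
  simp [map_sum, Fin.sum_univ_castSucc, PiLp.inner_apply, xT, xN, eN]

/-- Theorem 3.3, classical solvability of the transmission problem. -/
theorem classical_transmission_solvability (n : ℕ) (αt βt : ℝ)
    (hα : 0 < αt) (hβ : 0 ≤ βt) :
    ∃ C : ℝ, ∀ h : En (n + 1) → ℝ, ContinuousOn h (sphere (0 : En (n + 1)) 1) →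
      ∃ v : En (n + 1) → ℝ,
        (ContinuousOn v (closedBall (0 : En (n + 1)) 1) ∧
          Set.EqOn v h (sphere (0 : En (n + 1)) 1) ∧
          ClassicalTrans αt βt (ball (0 : En (n + 1)) 1) v) ∧
        (∀ v' : En (n + 1) → ℝ,
          ContinuousOn v' (closedBall (0 : En (n + 1)) 1) →
          Set.EqOn v' h (sphere (0 : En (n + 1)) 1) →
          ClassicalTrans αt βt (ball (0 : En (n + 1)) 1) v' →
          Set.EqOn v' v (closedBall (0 : En (n + 1)) 1)) ∧
        (∀ M : ℝ, (∀ x ∈ closedBall (0 : En (n + 1)) 1, |v x| ≤ M) →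
          ∀ xb ∈ ball (0 : En (n + 1)) (1 / 2), xN xb = 0 →
            ∃ (ν : En n) (p q : ℝ), αt ^ 2 * p - βt ^ 2 * q = 0 ∧
              ∀ r : ℝ, 0 < r → r ≤ 1 / 4 → ∀ x ∈ ball xb r,
                |v x - v xb - (⟪ν, xT x - xT xb⟫ + p * pos (xN x) - q * neg (xN x))|
                  ≤ C * M * r ^ 2) := by
  obtain ⟨K, hK0, hK⟩ := exists_taylor_bound_poissonInt n
  refine ⟨3 * K, fun h hh => ⟨transSol αt βt h, ⟨continuousOn_transSol hh, transSol_eqOn_sphere hα,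
    classicalTrans_transSol hh⟩, fun v' hc he ht => eqOn_of_classicalTrans hα hc
      (continuousOn_transSol hh) (he.trans (transSol_eqOn_sphere hα).symm) ht
      (classicalTrans_transSol hh), fun M hM xb hxb hxbN => ?_⟩⟩
  have hxb1 : xb ∈ ball (0 : En (n + 1)) 1 := ball_subset_ball (by norm_num) hxb
  have hxb2 : xb ∈ closedBall (0 : En (n + 1)) (3 / 4) :=
    closedBall_subset_closedBall (by norm_num) (ball_subset_closedBall hxb)
  have hMh : ∀ y ∈ sphere (0 : En (n + 1)) 1, |h y| ≤ M := fun y hy => by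
    have := hM y (sphere_subset_closedBall hy)
    rwa [transSol_eqOn_sphere hα hy] at this
  set D : ℝ → En (n + 1) →L[ℝ] ℝ := fun c => fderiv ℝ (poissonInt (transData αt βt c h)) xb
  have hν : ∀ c c' : ℝ, (fun i : Fin n => D c (EuclideanSpace.single i.castSucc 1)) =
      fun i : Fin n => D c' (EuclideanSpace.single i.castSucc 1) := by
    intro c c'
    ext i
    have he : xN (EuclideanSpace.single i.castSucc 1 : En (n + 1)) = 0 := by
      simp [xN, (Fin.castSucc_ne_last _).symm]
    simp only [D]
    rw [fderiv_poissonInt_transData hh _ hxb1, fderiv_poissonInt_transData hh _ hxb1,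
      fderiv_poissonInt_oddData hh hxb1 hxbN he]
    simp
  refine ⟨WithLp.toLp 2 (fun i => D (βt ^ 2) (EuclideanSpace.single i.castSucc 1)),
    D (βt ^ 2) (eN n), D (αt ^ 2) (eN n), ?_, fun r hr hr4 x hx => ?_⟩
  · simp only [D]
    rw [fderiv_poissonInt_transData hh _ hxb1, fderiv_poissonInt_transData hh _ hxb1,
      fderiv_poissonInt_evenData_eN hh hxb1 hxbN]
    ring
  have hxr : ‖x - xb‖ < r := by rwa [← dist_eq_norm]
  have hx2 : x ∈ closedBall (0 : En (n + 1)) (3 / 4) := by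
    have h1 : ‖xb‖ < 1 / 2 := by simpa using hxb
    have h2 := norm_le_norm_add_norm_sub' x xb
    rw [mem_closedBall, dist_zero_right]
    linarith
  have hx1 : x ∈ ball (0 : En (n + 1)) 1 := closedBall_subset_ball (by norm_num) hx2
  have hM0 : 0 ≤ M := (abs_nonneg _).trans (hM xb (ball_subset_closedBall hxb1))
  have hxT : xT (x - xb) = xT x - xT xb := by
    ext i
    simp [xT]
  have hxN : xN (x - xb) = xN x := by
    have : xN (x - xb) = xN x - xN xb := rfl
    rw [this, hxbN, sub_zero]
  have main : ∀ c, 0 ≤ c → c ≤ αt ^ 2 + βt ^ 2 →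
      |dirichletExt (transData αt βt c h) x - dirichletExt (transData αt βt c h) xb -
        (⟪WithLp.toLp 2 (fun i => D (βt ^ 2) (EuclideanSpace.single i.castSucc 1)), xT x - xT xb⟫ +
          xN x * D c (eN n))| ≤ 3 * K * M * r ^ 2 := by
    intro c hc0 hc
    have h1 := hK _ (continuousOn_transData hh c) (3 * M)
      (fun y hy => abs_transData_le hα hc0 hc hMh hy) xb hxb2 x hx2
    have h2 := clm_apply_eq_inner_add (D c) (x - xb)
    rw [hxT, hxN, hν c (βt ^ 2)] at h2
    rw [dirichletExt_of_mem_ball _ hx1, dirichletExt_of_mem_ball _ hxb1, ← h2]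
    refine h1.trans ?_
    calc K * (3 * M) * ‖x - xb‖ ^ 2 ≤ K * (3 * M) * r ^ 2 := by gcongr
      _ = 3 * K * M * r ^ 2 := by ring
  rcases le_total 0 (xN x) with hs | hs
  · rw [transSol_of_nonneg hs, transSol_of_nonneg hxbN.ge]
    have := main (βt ^ 2) (by positivity) (by linarith [sq_nonneg αt])
    simpa [pos, neg, max_eq_left hs, max_eq_right (neg_nonpos.2 hs), mul_comm] using this
  · rw [transSol_of_nonpos hh hs,
      transSol_of_nonpos hh hxbN.le]
    have := main (αt ^ 2) (by positivity) (by linarith [sq_nonneg βt])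
    simpa [pos, neg, max_eq_right hs, max_eq_left (neg_nonneg.2 hs), mul_comm] using this

end TwoPhase
end
end
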